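/- arXiv:2003.06293 — 3 statements merged into one kernel-verified Lean document; each statement's English description precedes it below -/
import Mathlib

section
/- Let A and B be two closed discrete subsets of the infinite rational projective space ℚP^∞. If A and B are both deep or both shallow, then every bijection f : A → B extends to a homeomorphism h of ℚP^∞ onto itself such that h restricted to A equals f (in particular h(A) = B). -/
open Set Topology TopologicalSpace

/-- "Regular" in the sense of the paper: Hausdorff + the T₃ separation property. -/
def RegularHausdorff (X : Type*) [TopologicalSpace X] : Prop :=
  T2Space X ∧ RegularSpace X

/-- A space is superconnected if the closures of any finitely many nonempty open
sets have nonempty intersection. -/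
def Superconnected (X : Type*) [TopologicalSpace X] : Prop :=
  ∀ (n : ℕ) (U : Fin (n + 1) → Set X), (∀ i, IsOpen (U i)) → (∀ i, (U i).Nonempty) →
    (⋂ i, closure (U i)).Nonempty

/-- A space is coregular if it is Hausdorff and the complement of the intersection
of the closures of any finitely many nonempty open sets is a regular space. -/
def Coregular (X : Type*) [TopologicalSpace X] : Prop :=
  T2Space X ∧ ∀ (n : ℕ) (U : Fin (n + 1) → Set X), (∀ i, IsOpen (U i)) →
    (∀ i, (U i).Nonempty) → RegularHausdorff ↥((⋂ i, closure (U i))ᶜ)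

/-- Vanishing sequence of closed sets. -/
def VanishingSeq {X : Type*} [TopologicalSpace X] (A : ℕ → Set X) : Prop :=
  (∀ n, IsClosed (A n)) ∧ A 0 = univ ∧ (⋂ n, A n) = ∅ ∧ ∀ n, A (n + 1) ⊆ A n

def IsCoregularSkeleton {X : Type*} [TopologicalSpace X] (A : ℕ → Set X) : Prop :=
  VanishingSeq A ∧
  (∀ U : Set X, IsOpen U → U.Nonempty → ∃ n, A n ⊆ closure U) ∧
  (∀ n, RegularHausdorff ↥((A n)ᶜ))

def IsSuperconnectingSkeleton {X : Type*} [TopologicalSpace X] (A : ℕ → Set X) : Prop :=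
  VanishingSeq A ∧
  ∀ U : Set X, IsOpen U → U.Nonempty → ∃ n, (A n).Nonempty ∧ A n ⊆ closure U

def IsInductivelySuperconnectingSkeleton {X : Type*} [TopologicalSpace X]
    (A : ℕ → Set X) : Prop :=
  VanishingSeq A ∧
  ∀ (n : ℕ) (V : Set X), IsOpen V → (V ∩ A n).Nonempty →
    ∃ m, (A m).Nonempty ∧ A m ⊆ closure (V ∩ A n)

def IsSuperskeleton {X : Type*} [TopologicalSpace X] (A : ℕ → Set X) : Prop :=
  IsCoregularSkeleton A ∧ IsInductivelySuperconnectingSkeleton A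

def IsCanonicalSuperskeleton {X : Type*} [TopologicalSpace X] (A : ℕ → Set X) : Prop :=
  IsSuperskeleton A ∧
  ∀ n, IsNowhereDense ((Subtype.val ⁻¹' A (n + 1)) : Set ↥(A n))

/-- Points of the projective space: finitely supported nonzero sequences. -/
abbrev ProjPoint (F : Type*) [Field F] : Type _ :=
  {x : ℕ → F // {n | x n ≠ 0}.Finite ∧ x ≠ 0}

/-- Proportionality of finitely supported nonzero sequences. -/
def projSetoid (F : Type*) [Field F] : Setoid (ProjPoint F) where
  r x y := ∃ l : F, l ≠ 0 ∧ (x : ℕ → F) = l • (y : ℕ → F)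
  iseqv := by
    refine ⟨fun x => ⟨1, one_ne_zero, by simp⟩, ?_, ?_⟩
    · rintro x y ⟨l, hl, h⟩
      exact ⟨l⁻¹, inv_ne_zero hl, by rw [h, smul_smul, inv_mul_cancel₀ hl, one_smul]⟩
    · rintro x y z ⟨l, hl, h⟩ ⟨m, hm, h'⟩
      exact ⟨l * m, mul_ne_zero hl hm, by rw [h, h', smul_smul]⟩

/-- The infinite projective space of a topological field. -/
abbrev ProjSpace (F : Type*) [Field F] [TopologicalSpace F] : Type _ :=
  Quotient (projSetoid F)

/-- The infinite rational projective space ℚP^∞. -/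
abbrev QPinf : Type := ProjSpace ℚ


/-- A subset is deep if it has finite complement outside the intersection of the
closures of any finitely many nonempty open sets. -/
def DeepSet {X : Type*} [TopologicalSpace X] (A : Set X) : Prop :=
  ∀ (n : ℕ) (U : Fin (n + 1) → Set X), (∀ i, IsOpen (U i)) → (∀ i, (U i).Nonempty) →
    (A \ ⋂ i, closure (U i)).Finite

/-- A subset is shallow if it misses the intersection of the closures of some finitely
many nonempty open sets. -/
def ShallowSet {X : Type*} [TopologicalSpace X] (A : Set X) : Prop :=
  ∃ (n : ℕ) (U : Fin (n + 1) → Set X), (∀ i, IsOpen (U i)) ∧ (∀ i, (U i).Nonempty) ∧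
    A ∩ ⋂ i, closure (U i) = ∅

namespace QPinf

/-- The canonical projection onto the projective space. -/
abbrev mk (v : ProjPoint ℚ) : QPinf := Quotient.mk (projSetoid ℚ) v

theorem mk_eq_mk {v w : ProjPoint ℚ} :
    mk v = mk w ↔ ∃ l : ℚ, l ≠ 0 ∧ (v : ℕ → ℚ) = l • (w : ℕ → ℚ) :=
  Quotient.eq (r := projSetoid ℚ)

theorem exists_rep (x : QPinf) : ∃ v, mk v = x := Quotient.exists_rep x

theorem continuous_mk : Continuous mk := continuous_quotient_mk'

theorem isOpen_iff {S : Set QPinf} : IsOpen S ↔ IsOpen (mk ⁻¹' S) := Iff.rfl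

theorem isClosed_iff {S : Set QPinf} : IsClosed S ↔ IsClosed (mk ⁻¹' S) := by
  rw [← isOpen_compl_iff, isOpen_iff, preimage_compl, isOpen_compl_iff]

theorem exists_apply_ne_zero (v : ProjPoint ℚ) : ∃ i, v.1 i ≠ 0 :=
  Function.ne_iff.1 v.2.2

theorem continuous_coord (i : ℕ) : Continuous fun v : ProjPoint ℚ => v.1 i :=
  (continuous_apply i).comp continuous_subtype_val

/-- The set of points whose first `m` homogeneous coordinates vanish. -/
def skeleton (m : ℕ) : Set QPinf := {x | ∀ v, mk v = x → ∀ i < m, v.1 i = 0}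

theorem mk_mem_skeleton {m : ℕ} {v : ProjPoint ℚ} :
    mk v ∈ skeleton m ↔ ∀ i < m, v.1 i = 0 := by
  refine ⟨fun h => h v rfl, fun h w hw i hi => ?_⟩
  obtain ⟨l, -, hl⟩ := mk_eq_mk.1 hw
  simp [hl, h i hi]

theorem skeleton_anti {m n : ℕ} (h : m ≤ n) : skeleton n ⊆ skeleton m :=
  fun _ hx v hv i hi => hx v hv i (hi.trans_le h)

theorem isClosed_skeleton (m : ℕ) : IsClosed (skeleton m) := by
  have : mk ⁻¹' skeleton m = ⋂ i, ⋂ (_ : i < m), {v | v.1 i = 0} := by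
    ext v
    simp [mk_mem_skeleton]
  rw [isClosed_iff, this]
  exact isClosed_iInter fun i => isClosed_iInter fun _ =>
    isClosed_eq (continuous_coord i) continuous_const

theorem skeleton_nonempty (m : ℕ) : (skeleton m).Nonempty := by
  refine ⟨mk ⟨Pi.single m 1, (Set.finite_singleton m).subset fun i hi => by
    by_contra h
    exact hi (by simp [Pi.single_eq_of_ne h]), Function.ne_iff.2 ⟨m, by simp⟩⟩, ?_⟩
  exact mk_mem_skeleton.2 fun i hi => Pi.single_eq_of_ne hi.ne _

theorem exists_notMem_skeleton (x : QPinf) : ∃ m, ∀ n ≥ m, x ∉ skeleton n := by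
  obtain ⟨v, rfl⟩ := exists_rep x
  obtain ⟨i, hi⟩ := exists_apply_ne_zero v
  exact ⟨i + 1, fun n hn h => hi (mk_mem_skeleton.1 h i hn)⟩

theorem exists_forall_notMem_skeleton {S : Set QPinf} (hS : S.Finite) :
    ∃ m, ∀ n ≥ m, ∀ x ∈ S, x ∉ skeleton n := by
  choose m hm using exists_notMem_skeleton
  obtain ⟨N, hN⟩ := (hS.image m).bddAbove
  exact ⟨N, fun n hn x hx => hm x n ((hN (mem_image_of_mem m hx)).trans hn)⟩

/-- `C` is determined by the first `m` homogeneous coordinates. -/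
def DeterminedBy (m : ℕ) (C : Set QPinf) : Prop :=
  ∀ v w : ProjPoint ℚ, (∀ i < m, v.1 i = w.1 i) → (mk v ∈ C ↔ mk w ∈ C)

theorem DeterminedBy.mono {m n : ℕ} {C : Set QPinf} (h : DeterminedBy m C) (hmn : m ≤ n) :
    DeterminedBy n C :=
  fun v w hvw => h v w fun i hi => hvw i (hi.trans_le hmn)

theorem determinedBy_skeleton (m : ℕ) : DeterminedBy m (skeleton m) := by
  intro v w h
  rw [mk_mem_skeleton, mk_mem_skeleton]
  exact forall₂_congr fun i hi => by rw [h i hi]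

theorem exists_det_ne_zero {v w : ProjPoint ℚ} (h : mk v ≠ mk w) :
    ∃ i j, v.1 i * w.1 j - v.1 j * w.1 i ≠ 0 := by
  by_contra! H
  obtain ⟨j, hj⟩ := exists_apply_ne_zero w
  have key : v.1 = (v.1 j / w.1 j) • w.1 := by
    ext i
    have := H i j
    simp only [Pi.smul_apply, smul_eq_mul]
    field_simp
    linarith
  refine h (mk_eq_mk.2 ⟨_, fun h0 => v.2.2 ?_, key⟩)
  rw [key, h0, zero_smul]

instance : T2Space QPinf := by
  refine ⟨fun x y hxy => ?_⟩
  obtain ⟨v, rfl⟩ := exists_rep x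
  obtain ⟨w, rfl⟩ := exists_rep y
  obtain ⟨i, j, hij⟩ := exists_det_ne_zero hxy
  have hc : ∀ z : ProjPoint ℚ,
      Continuous fun u : ProjPoint ℚ => |u.1 i * z.1 j - u.1 j * z.1 i| := fun z =>
    (((continuous_coord i).mul continuous_const).sub
      ((continuous_coord j).mul continuous_const)).abs
  have hmem : ∀ a b u : ProjPoint ℚ,
      mk u ∈ mk '' {u | |u.1 i * a.1 j - u.1 j * a.1 i| < |u.1 i * b.1 j - u.1 j * b.1 i|} ↔
      |u.1 i * a.1 j - u.1 j * a.1 i| < |u.1 i * b.1 j - u.1 j * b.1 i| := by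
    refine fun a b u => ⟨?_, fun h => ⟨u, h, rfl⟩⟩
    rintro ⟨u', h, hu⟩
    obtain ⟨l, hl, e⟩ := mk_eq_mk.1 hu
    have h' : |l| * |u.1 i * a.1 j - u.1 j * a.1 i| <
        |l| * |u.1 i * b.1 j - u.1 j * b.1 i| := by
      simpa [e, ← abs_mul, mul_sub, mul_assoc] using h
    exact lt_of_mul_lt_mul_left h' (abs_nonneg l)
  have hopen : ∀ a b : ProjPoint ℚ, IsOpen (mk '' {u | |u.1 i * a.1 j - u.1 j * a.1 i| <
      |u.1 i * b.1 j - u.1 j * b.1 i|}) := by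
    intro a b
    rw [isOpen_iff]
    convert isOpen_lt (hc a) (hc b) using 1
    ext u
    exact hmem a b u
  refine ⟨_, _, hopen v w, hopen w v, (hmem _ _ _).2 ?_, (hmem _ _ _).2 ?_, ?_⟩
  · rw [mul_comm (v.1 j) (v.1 i), sub_self, abs_zero]
    exact abs_pos.2 hij
  · rw [mul_comm (w.1 j) (w.1 i), sub_self, abs_zero]
    refine abs_pos.2 fun h => hij ?_
    linarith
  · rw [Set.disjoint_left]
    intro z hz hz'
    obtain ⟨u, rfl⟩ := exists_rep z
    exact lt_asymm ((hmem _ _ _).1 hz) ((hmem _ _ _).1 hz')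

instance : Countable QPinf := by
  have : Countable (ProjPoint ℚ) := by
    refine Function.Injective.countable (β := ℕ →₀ ℚ)
      (f := fun v => Finsupp.ofSupportFinite v.1 v.2.1) fun v w h => Subtype.ext ?_
    exact congrArg (fun f : ℕ →₀ ℚ => (f : ℕ → ℚ)) h
  exact Quotient.countable

/-- A neighborhood of a point contains a box in finitely many coordinates. -/
theorem exists_box {U : Set (ProjPoint ℚ)} (hU : IsOpen U) {v : ProjPoint ℚ} (hv : v ∈ U) :
    ∃ n : ℕ, ∃ ε : ℝ, 0 < ε ∧
      ∀ w : ProjPoint ℚ, (∀ i < n, |((w.1 i - v.1 i : ℚ) : ℝ)| < ε) → w ∈ U := by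
  obtain ⟨W, hW, rfl⟩ := isOpen_induced_iff.1 hU
  obtain ⟨I, u, hu, hIW⟩ := isOpen_pi_iff.1 hW v.1 hv
  have : ∀ i : ℕ, ∃ ε : ℝ, 0 < ε ∧ ∀ q : ℚ, i ∈ I → |((q - v.1 i : ℚ) : ℝ)| < ε → q ∈ u i := by
    intro i
    by_cases hi : i ∈ I
    · obtain ⟨ε, hε, h⟩ := Metric.isOpen_iff.1 (hu i hi).1 _ (hu i hi).2
      refine ⟨ε, hε, fun q _ hq => h ?_⟩
      rw [Metric.mem_ball, Rat.dist_eq]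
      exact_mod_cast hq
    · exact ⟨1, one_pos, fun q h => absurd h hi⟩
  choose e he hq using this
  obtain ⟨n, hn⟩ := I.exists_nat_subset_range
  obtain ⟨ε, hε, hle⟩ : ∃ ε : ℝ, 0 < ε ∧ ∀ i ∈ I, ε ≤ e i := by
    rcases I.eq_empty_or_nonempty with rfl | hI
    · exact ⟨1, one_pos, by simp⟩
    · exact ⟨I.inf' hI e, by simpa [Finset.lt_inf'_iff] using fun i _ => he i,
        fun i hi => Finset.inf'_le e hi⟩
  refine ⟨n, ε, hε, fun w hw => hIW fun i hi => hq i _ hi ?_⟩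
  exact (hw i (Finset.mem_range.1 (hn hi))).trans_le (hle i hi)

theorem exists_nhds_determined {x : QPinf} {O : Set QPinf} (hO : IsOpen O) (hx : x ∈ O) :
    ∃ M, ∀ m ≥ M, ∃ N ⊆ O, x ∈ N ∧ IsOpen N ∧ IsClosed (N ∪ skeleton m) ∧ DeterminedBy m N := by
  obtain ⟨v₀, rfl⟩ := exists_rep x
  obtain ⟨s, hs⟩ := exists_apply_ne_zero v₀
  obtain ⟨v, hv, hvs⟩ : ∃ v : ProjPoint ℚ, mk v = mk v₀ ∧ v.1 s = 1 := by
    refine ⟨⟨(v₀.1 s)⁻¹ • v₀.1, v₀.2.1.subset fun i hi => ?_,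
      smul_ne_zero (inv_ne_zero hs) v₀.2.2⟩, mk_eq_mk.2 ⟨_, inv_ne_zero hs, rfl⟩, ?_⟩
    · simp_all
    · simp [hs]
  rw [← hv] at hx ⊢
  obtain ⟨n, ε, hε, hbox⟩ := exists_box (isOpen_iff.1 hO) hx
  obtain ⟨r, hr, hr0, hrε⟩ := exists_irrational_btwn hε
  refine ⟨max n (s + 1), fun m hm => ?_⟩
  have hnm : n ≤ m := (le_max_left _ _).trans hm
  have hsm : s < m := (le_max_right _ _).trans hm
  let P : ProjPoint ℚ → Prop := fun w =>
    ∀ i < m, |((w.1 i - v.1 i * w.1 s : ℚ) : ℝ)| < r * |((w.1 s : ℚ) : ℝ)|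
  have hP : ∀ w, mk w ∈ mk '' {w | P w} ↔ P w := by
    refine fun w => ⟨?_, fun h => ⟨w, h, rfl⟩⟩
    rintro ⟨w', h, hw⟩ i hi
    obtain ⟨l, hl, e⟩ := mk_eq_mk.1 hw
    have h' : |(l : ℝ)| * |((w.1 i - v.1 i * w.1 s : ℚ) : ℝ)| <
        |(l : ℝ)| * (r * |((w.1 s : ℚ) : ℝ)|) := by
      have := h i hi
      rw [e] at this
      simp only [Pi.smul_apply, smul_eq_mul] at this
      rw [show l * w.1 i - v.1 i * (l * w.1 s) = l * (w.1 i - v.1 i * w.1 s) by ring,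
        Rat.cast_mul, Rat.cast_mul, abs_mul, abs_mul] at this
      linarith
    exact lt_of_mul_lt_mul_left h' (abs_nonneg _)
  have hc : ∀ i, Continuous fun w : ProjPoint ℚ => |((w.1 i - v.1 i * w.1 s : ℚ) : ℝ)| := fun i =>
    (Rat.continuous_coe_real.comp
      ((continuous_coord i).sub (continuous_const.mul (continuous_coord s)))).abs
  have hc' : Continuous fun w : ProjPoint ℚ => r * |((w.1 s : ℚ) : ℝ)| :=
    continuous_const.mul (Rat.continuous_coe_real.comp (continuous_coord s)).abs
  have hne : ∀ w, P w → w.1 s ≠ 0 := by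
    intro w hw h0
    have := hw s hsm
    simp [h0] at this
  refine ⟨mk '' {w | P w}, ?_, (hP v).2 ?_, ?_, ?_, ?_⟩
  · rintro _ ⟨w, hw, rfl⟩
    have hws := hne w hw
    obtain ⟨u, hu, huw⟩ : ∃ u : ProjPoint ℚ, mk u = mk w ∧ u.1 = (w.1 s)⁻¹ • w.1 := by
      refine ⟨⟨(w.1 s)⁻¹ • w.1, w.2.1.subset fun i hi => ?_,
        smul_ne_zero (inv_ne_zero hws) w.2.2⟩, mk_eq_mk.2 ⟨_, inv_ne_zero hws, rfl⟩, rfl⟩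
      simp_all
    rw [← hu]
    refine hbox u fun i hi => lt_trans ?_ hrε
    have hpos : 0 < |((w.1 s : ℚ) : ℝ)| := abs_pos.2 (by exact_mod_cast hws)
    have := hw i (hi.trans_le hnm)
    refine lt_of_mul_lt_mul_right (lt_of_eq_of_lt ?_ this) hpos.le
    rw [← abs_mul, huw]
    norm_cast
    congr 2
    simp only [Pi.smul_apply, smul_eq_mul]
    field_simp
  · intro i hi
    simp [hvs, hr0]
  · rw [isOpen_iff]
    have : mk ⁻¹' (mk '' {w | P w}) = ⋂ i ∈ Finset.range m,
        {w : ProjPoint ℚ | |((w.1 i - v.1 i * w.1 s : ℚ) : ℝ)| < r * |((w.1 s : ℚ) : ℝ)|} := by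
      ext w
      rw [mem_preimage, hP]
      simp [P]
    rw [this]
    exact isOpen_biInter_finset fun i _ => isOpen_lt (hc i) hc'
  · rw [isClosed_iff]
    have : mk ⁻¹' (mk '' {w | P w} ∪ skeleton m) = ⋂ i, ⋂ (_ : i < m),
        {w : ProjPoint ℚ | |((w.1 i - v.1 i * w.1 s : ℚ) : ℝ)| ≤ r * |((w.1 s : ℚ) : ℝ)|} := by
      ext w
      rw [mem_preimage, mem_union, hP, mk_mem_skeleton]
      simp only [mem_iInter, mem_ofPred_eq]
      constructor
      · rintro (h | h) i hi
        · exact (h i hi).le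
        · simp [h i hi, h s hsm]
      · intro h
        by_cases h0 : w.1 s = 0
        · right
          intro i hi
          simpa [h0] using h i hi
        · left
          refine fun i hi => (h i hi).lt_of_ne fun heq => ?_
          refine hr ⟨|w.1 i - v.1 i * w.1 s| / |w.1 s|, ?_⟩
          have hpos : |((w.1 s : ℚ) : ℝ)| ≠ 0 := abs_ne_zero.2 (by exact_mod_cast h0)
          rw [Rat.cast_div, div_eq_iff (by exact_mod_cast hpos)]
          exact_mod_cast heq
    rw [this]
    exact isClosed_iInter fun i => isClosed_iInter fun _ => isClosed_le (hc i) hc'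
  · intro a b hab
    rw [hP, hP]
    exact forall₂_congr fun i hi => by rw [hab i hi, hab s hsm]

/-- An involutive reflection of the projective space exchanging two given points. -/
theorem exists_reflection {x y : QPinf} (hxy : x ≠ y) :
    ∃ τ : QPinf → QPinf, Continuous τ ∧ Function.Involutive τ ∧ τ x = y ∧
      (∃ M, ∀ m ≥ M, ∀ z ∈ skeleton m, τ z = z) ∧
      ∀ k, x ∈ skeleton k → y ∈ skeleton k → ∀ C, DeterminedBy k C → ∀ z, τ z ∈ C ↔ z ∈ C := by
  obtain ⟨v, rfl⟩ := exists_rep x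
  obtain ⟨w, rfl⟩ := exists_rep y
  obtain ⟨i, j, hij⟩ := exists_det_ne_zero hxy
  obtain ⟨α, β, hv, hw⟩ : ∃ α β : ℚ, α * v.1 i + β * v.1 j = 1 ∧ α * w.1 i + β * w.1 j = -1 := by
    refine ⟨(w.1 j + v.1 j) / (v.1 i * w.1 j - v.1 j * w.1 i),
      (-v.1 i - w.1 i) / (v.1 i * w.1 j - v.1 j * w.1 i), ?_, ?_⟩ <;>
    rw [div_mul_eq_mul_div, div_mul_eq_mul_div, ← add_div, div_eq_iff hij] <;> ring
  let T : (ℕ → ℚ) → ℕ → ℚ := fun u => u - (α * u i + β * u j) • (v.1 - w.1)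
  have hT : ∀ u, T (T u) = u := by
    intro u
    ext n
    simp only [T, Pi.sub_apply, Pi.smul_apply, smul_eq_mul]
    linear_combination (α * u i + β * u j) * (v.1 n - w.1 n) * (hv - hw)
  have hTs : ∀ (l : ℚ) u, T (l • u) = l • T u := by
    intro l u
    ext n
    simp only [T, Pi.sub_apply, Pi.smul_apply, smul_eq_mul]
    ring
  have hTc : Continuous T := by
    refine continuous_pi fun n => ?_
    simp only [T, Pi.sub_apply, Pi.smul_apply, smul_eq_mul]
    fun_prop
  let S : ProjPoint ℚ → ProjPoint ℚ := fun u => ⟨T u.1, by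
    refine ((u.2.1.union v.2.1).union w.2.1).subset fun n hn => ?_
    by_contra! h
    simp only [mem_union, mem_ofPred_eq, not_or, not_not] at h
    exact hn (by simp [T, h]), fun h => u.2.2 <| by
      rw [← hT u.1, h]
      ext n
      simp [T]⟩
  have hS : ∀ a b : ProjPoint ℚ, (projSetoid ℚ).r a b → (projSetoid ℚ).r (S a) (S b) := by
    rintro a b ⟨l, hl, h⟩
    exact ⟨l, hl, by simp only [S]; rw [h, hTs]⟩
  have hSc : Continuous S := (hTc.comp continuous_subtype_val).subtype_mk _
  refine ⟨Quotient.map S hS, hSc.quotient_map' hS, ?_, ?_, ⟨max i j + 1, ?_⟩, ?_⟩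
  · intro z
    obtain ⟨u, rfl⟩ := exists_rep z
    exact congrArg mk (Subtype.ext (hT u.1))
  · refine congrArg mk (Subtype.ext ?_)
    simp only [S, T, hv, one_smul, sub_sub_cancel]
  · intro m hm z hz
    obtain ⟨u, rfl⟩ := exists_rep z
    rw [mk_mem_skeleton] at hz
    have hi := hz i (by omega)
    have hj := hz j (by omega)
    refine congrArg mk (Subtype.ext ?_)
    simp only [S, T, hi, hj, mul_zero, add_zero, zero_smul, sub_zero]
  · intro k hx hy C hC z
    obtain ⟨u, rfl⟩ := exists_rep z
    refine hC (S u) u fun n hn => ?_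
    simp [S, T, mk_mem_skeleton.1 hx n hn, mk_mem_skeleton.1 hy n hn]

theorem frontier_subset_of_isClosed_union {V K : Set QPinf} (hV : IsOpen V)
    (hVK : IsClosed (V ∪ K)) : frontier V ⊆ K := by
  intro z hz
  rw [hV.frontier_eq] at hz
  exact (hVK.closure_subset_iff.2 subset_union_left hz.1).resolve_left hz.2

/-- Two points can be exchanged by a homeomorphism supported near these points. -/
theorem exists_swap_local {x y : QPinf} {U V : Set QPinf} (hU : IsOpen U) (hV : IsOpen V)
    (hx : x ∈ U) (hy : y ∈ V) :
    ∃ g : QPinf ≃ₜ QPinf, g x = y ∧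
      (∀ z, g z = z ∨ (z ∈ U ∧ g z ∈ V) ∨ (z ∈ V ∧ g z ∈ U)) ∧
      ∀ k, x ∈ skeleton k → y ∈ skeleton k → ∀ C, DeterminedBy k C → ∀ z, g z ∈ C ↔ z ∈ C := by
  classical
  by_cases hxy : x = y
  · exact ⟨Homeomorph.refl _, by simpa using hxy, fun z => Or.inl rfl, fun _ _ _ _ _ _ => Iff.rfl⟩
  obtain ⟨τ, hτc, hτ, hτx, ⟨M, hM⟩, hτC⟩ := exists_reflection hxy
  have hO : IsOpen (U ∩ τ ⁻¹' V) := hU.inter (hV.preimage hτc)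
  obtain ⟨M', hM'⟩ := exists_nhds_determined hO ⟨hx, by simpa [hτx] using hy⟩
  obtain ⟨N, hNO, hxN, hN, hNc, -⟩ := hM' (max M M') (le_max_right _ _)
  set m := max M M'
  have hm : ∀ z ∈ skeleton m, τ z = z := hM m (le_max_left _ _)
  let S : Set QPinf := N ∪ τ ⁻¹' N
  have hS : IsOpen S := hN.union (hN.preimage hτc)
  have hSc : IsClosed (S ∪ skeleton m) := by
    have : S ∪ skeleton m = (N ∪ skeleton m) ∪ τ ⁻¹' (N ∪ skeleton m) := by
      have h1 : τ ⁻¹' skeleton m = skeleton m := by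
        ext z
        exact ⟨fun h => by rw [← hτ z, hm _ h]; exact h, fun h => by rw [mem_preimage, hm _ h]; exact h⟩
      rw [preimage_union, h1]
      ext z
      simp only [S, mem_union]
      tauto
    rw [this]
    exact hNc.union (hNc.preimage hτc)
  have hfr : frontier S ⊆ skeleton m := frontier_subset_of_isClosed_union hS hSc
  have hτS : ∀ z, τ z ∈ S ↔ z ∈ S := fun z => by
    simp only [S, mem_union, mem_preimage, hτ z]
    tauto
  let g : QPinf → QPinf := S.piecewise τ id
  have hg1 : ∀ z ∈ S, g z = τ z := fun z hz => piecewise_eq_of_mem _ _ _ hz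
  have hg2 : ∀ z ∉ S, g z = z := fun z hz => piecewise_eq_of_notMem _ _ _ hz
  have hgc : Continuous g := hτc.piecewise (fun z hz => hm z (hfr hz)) continuous_id
  have hgi : Function.Involutive g := by
    intro z
    by_cases hz : z ∈ S
    · rw [hg1 z hz, hg1 _ ((hτS z).2 hz), hτ]
    · rw [hg2 z hz, hg2 z hz]
  refine ⟨⟨hgi.toPerm, hgc, hgc⟩, ?_, fun z => ?_, fun k hxk hyk C hC z => ?_⟩
  · exact (hg1 x (Or.inl hxN)).trans hτx
  · change g z = z ∨ (z ∈ U ∧ g z ∈ V) ∨ (z ∈ V ∧ g z ∈ U)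
    by_cases hz : z ∈ S
    · rw [hg1 z hz]
      rcases hz with h | h
      · exact Or.inr (Or.inl (hNO h))
      · refine Or.inr (Or.inr ⟨?_, (hNO h).1⟩)
        have := (hNO h).2
        rwa [mem_preimage, hτ] at this
    · exact Or.inl (hg2 z hz)
  · change g z ∈ C ↔ z ∈ C
    by_cases hz : z ∈ S
    · rw [hg1 z hz]
      exact hτC k hxk hyk C hC z
    · rw [hg2 z hz]

/-- A finite family of sets, each of which is determined by the coordinates below some `m` and has
its frontier in the `m`-th skeleton, where this skeleton belongs to the family too. -/
def Admissible (𝒞 : Set (Set QPinf)) : Prop :=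
  𝒞.Finite ∧ ∀ C ∈ 𝒞, ∃ m, skeleton m ∈ 𝒞 ∧ DeterminedBy m C ∧ frontier C ⊆ skeleton m

theorem Admissible.exists_determinedBy {𝒞 : Set (Set QPinf)} (h : Admissible 𝒞) :
    ∃ k, ∀ m ≥ k, ∀ C ∈ 𝒞, DeterminedBy m C := by
  have : ∀ C, ∃ m, C ∈ 𝒞 → DeterminedBy m C := fun C => by
    by_cases hC : C ∈ 𝒞
    · obtain ⟨m, -, hm, -⟩ := h.2 C hC
      exact ⟨m, fun _ => hm⟩
    · exact ⟨0, fun hC' => absurd hC' hC⟩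
  choose m hm using this
  obtain ⟨N, hN⟩ := (h.1.image m).bddAbove
  exact ⟨N, fun n hn C hC => (hm C hC).mono ((hN (mem_image_of_mem m hC)).trans hn)⟩

theorem Admissible.insert_skeleton {𝒞 : Set (Set QPinf)} (h : Admissible 𝒞) {m : ℕ}
    {V : Set QPinf} (hV : DeterminedBy m V) (hfr : frontier V ⊆ skeleton m) :
    Admissible (insert V (insert (skeleton m) 𝒞)) := by
  refine ⟨(h.1.insert _).insert _, ?_⟩
  rintro C (rfl | rfl | hC)
  · exact ⟨m, by simp, hV, hfr⟩
  · exact ⟨m, by simp, determinedBy_skeleton m, (isClosed_skeleton m).frontier_subset⟩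
  · obtain ⟨k, hk, h1, h2⟩ := h.2 C hC
    exact ⟨k, by simp [hk], h1, h2⟩

/-- Points not separated by an admissible family can be exchanged by a homeomorphism preserving
the family and fixing a given closed set. -/
theorem exists_swap {𝒞 : Set (Set QPinf)} (h𝒞 : Admissible 𝒞) {K : Set QPinf} (hK : IsClosed K)
    {x y : QPinf} (hx : x ∉ K) (hy : y ∉ K) (hxy : ∀ C ∈ 𝒞, x ∈ C ↔ y ∈ C) :
    ∃ g : QPinf ≃ₜ QPinf, g x = y ∧ (∀ z ∈ K, g z = z) ∧ ∀ C ∈ 𝒞, ∀ z, g z ∈ C ↔ z ∈ C := by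
  have key : ∀ a : QPinf, ∀ C ∈ 𝒞, ∃ W : Set QPinf, IsOpen W ∧ a ∈ W ∧
      (a ∉ frontier C → ∀ z ∈ W, z ∈ C ↔ a ∈ C) := by
    intro a C _
    by_cases ha : a ∈ frontier C
    · exact ⟨univ, isOpen_univ, mem_univ a, fun h => absurd ha h⟩
    by_cases haC : a ∈ C
    · refine ⟨interior C, isOpen_interior, ?_, fun _ z hz => iff_of_true (interior_subset hz) haC⟩
      by_contra h
      exact ha ⟨subset_closure haC, h⟩
    · refine ⟨(closure C)ᶜ, isClosed_closure.isOpen_compl, fun h => ha ⟨h, fun h' =>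
        haC (interior_subset h')⟩, fun _ z hz => iff_of_false (fun h => hz (subset_closure h)) haC⟩
  have key' : ∀ a ∉ K, ∃ W : Set QPinf, IsOpen W ∧ a ∈ W ∧ Disjoint W K ∧
      ∀ C ∈ 𝒞, a ∉ frontier C → ∀ z ∈ W, z ∈ C ↔ a ∈ C := by
    intro a ha
    choose! W hW haW hWC using key a
    refine ⟨Kᶜ ∩ ⋂ C ∈ 𝒞, W C, hK.isOpen_compl.inter (h𝒞.1.isOpen_biInter hW),
      ⟨ha, mem_iInter₂.2 haW⟩, disjoint_compl_left.mono_left inter_subset_left,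
      fun C hC hf z hz => hWC C hC hf z (mem_iInter₂.1 hz.2 C hC)⟩
  obtain ⟨U, hU, hxU, hUK, hUC⟩ := key' x hx
  obtain ⟨V, hV, hyV, hVK, hVC⟩ := key' y hy
  obtain ⟨g, hg, hgs, hgC⟩ := exists_swap_local hU hV hxU hyV
  refine ⟨g, hg, fun z hz => ?_, fun C hC z => ?_⟩
  · rcases hgs z with h | h | h
    · exact h
    · exact (Set.disjoint_left.1 hUK h.1 hz).elim
    · exact (Set.disjoint_left.1 hVK h.1 hz).elim
  · obtain ⟨m, hm, hdet, hfr⟩ := h𝒞.2 C hC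
    by_cases hxm : x ∈ skeleton m
    · exact hgC m hxm ((hxy _ hm).1 hxm) C hdet z
    · have hxf : x ∉ frontier C := fun h => hxm (hfr h)
      have hyf : y ∉ frontier C := fun h => hxm ((hxy _ hm).2 (hfr h))
      rcases hgs z with h | h | h
      · rw [h]
      · rw [hUC C hC hxf z h.1, hVC C hC hyf _ h.2, hxy C hC]
      · rw [hVC C hC hyf z h.1, hUC C hC hxf _ h.2, hxy C hC]

/-- Near every point there are other points with the same first homogeneous coordinates. -/
theorem exists_near {x : QPinf} {O : Set QPinf} (hO : IsOpen O) (hx : x ∈ O) (k : ℕ) :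
    ∃ y ∈ O, y ≠ x ∧ ∀ C, DeterminedBy k C → (x ∈ C ↔ y ∈ C) := by
  obtain ⟨v, rfl⟩ := exists_rep x
  obtain ⟨n, ε, hε, hbox⟩ := exists_box (isOpen_iff.1 hO) hx
  obtain ⟨N, hN⟩ := v.2.1.bddAbove
  set q := max (max n k) (N + 1)
  have hvq : v.1 q = 0 := by
    by_contra h
    have := hN h
    omega
  let w : ProjPoint ℚ := ⟨Function.update v.1 q 1,
    (v.2.1.insert q).subset fun i hi => by
      by_cases h : i = q
      · simp [h]
      · right; simpa [h] using hi,
    Function.ne_iff.2 ⟨q, by simp⟩⟩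
  have hw : ∀ i < q, w.1 i = v.1 i := fun i hi => Function.update_of_ne hi.ne _ _
  refine ⟨mk w, hbox w fun i hi => ?_, fun h => ?_, fun C hC => hC v w fun i hi => ?_⟩
  · simpa [hw i (by omega)] using hε
  · obtain ⟨l, -, e⟩ := mk_eq_mk.1 h
    have := congrFun e q
    simp [w, hvq] at this
  · rw [hw i (by omega)]

/-- The closure of a nonempty open set contains some skeleton. -/
theorem exists_skeleton_subset_closure {U : Set QPinf} (hU : IsOpen U) (hne : U.Nonempty) :
    ∃ m, ∀ n ≥ m, skeleton n ⊆ closure U := by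
  obtain ⟨x, hx⟩ := hne
  obtain ⟨v, rfl⟩ := exists_rep x
  obtain ⟨n, ε, hε, hbox⟩ := exists_box (isOpen_iff.1 hU) hx
  refine ⟨n, fun m hm z hz => ?_⟩
  obtain ⟨u, rfl⟩ := exists_rep z
  replace hz := mk_mem_skeleton.1 (skeleton_anti hm hz)
  by_cases hvu : mk u = mk v
  · rw [hvu]
    exact subset_closure hx
  have hne : ∀ s : ℚ, u.1 + s • v.1 ≠ 0 := by
    intro s h
    refine hvu (mk_eq_mk.2 ⟨-s, fun h0 => u.2.2 ?_, ?_⟩)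
    · simpa [neg_eq_zero.1 h0] using h
    · rw [neg_smul]
      exact eq_neg_of_add_eq_zero_left h
  let p : ℚ → ProjPoint ℚ := fun s => ⟨u.1 + s • v.1, (u.2.1.union v.2.1).subset fun i hi => by
    by_contra! h
    simp only [mem_union, mem_ofPred_eq, not_or, not_not] at h
    exact hi (by simp [h]), hne s⟩
  have hp : Continuous p := by
    refine Continuous.subtype_mk (continuous_pi fun i => ?_) _
    simp only [Pi.add_apply, Pi.smul_apply, smul_eq_mul]
    fun_prop
  have hmem : ∀ s ≠ 0, mk (p s) ∈ U := by
    intro s hs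
    have hpv : mk (⟨s⁻¹ • (p s).1, (p s).2.1.subset fun i hi => by simp_all,
        smul_ne_zero (inv_ne_zero hs) (p s).2.2⟩ : ProjPoint ℚ) = mk (p s) :=
      mk_eq_mk.2 ⟨_, inv_ne_zero hs, rfl⟩
    rw [← hpv]
    refine hbox _ fun i hi => ?_
    simpa [p, hz i hi, hs] using hε
  have h0 : mk (p 0) = mk u := congrArg mk (Subtype.ext (by simp [p]))
  have hlim : Filter.Tendsto (fun s => mk (p s)) (𝓝[≠] (0 : ℚ)) (𝓝 (mk u)) := by
    rw [← h0]
    exact ((continuous_mk.comp hp).tendsto 0).mono_left nhdsWithin_le_nhds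
  exact mem_closure_of_tendsto hlim (eventually_nhdsWithin_of_forall hmem)

theorem finite_notMem_skeleton {A : Set QPinf} (hA : DeepSet A) (α : QPinf ≃ₜ QPinf) (m : ℕ) :
    {x ∈ A | α x ∉ skeleton m}.Finite := by
  obtain ⟨x, -⟩ := skeleton_nonempty 0
  obtain ⟨y, -, hyx, -⟩ := exists_near isOpen_univ (mem_univ x) 0
  obtain ⟨U, V, hU, hV, hyU, hxV, hUV⟩ := t2_separation hyx
  obtain ⟨M, hM⟩ := exists_nhds_determined hU hyU
  obtain ⟨M', hM'⟩ := exists_nhds_determined hV hxV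
  obtain ⟨N, hNU, hyN, hN, hNc, -⟩ := hM (max (max M M') m) (by omega)
  obtain ⟨N', hNV, hxN, hN', hNc', -⟩ := hM' (max (max M M') m) (by omega)
  refine (hA 1 ![α ⁻¹' N, α ⁻¹' N'] ?_ ?_).subset ?_
  · rw [Fin.forall_fin_two]
    exact ⟨hN.preimage α.continuous, hN'.preimage α.continuous⟩
  · rw [Fin.forall_fin_two]
    exact ⟨⟨α.symm y, by simpa using hyN⟩, ⟨α.symm x, by simpa using hxN⟩⟩
  · rintro z ⟨hzA, hz⟩
    refine ⟨hzA, fun h => hz ?_⟩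
    rw [mem_iInter, Fin.forall_fin_two] at h
    simp only [Matrix.cons_val_zero, Matrix.cons_val_one, ← α.preimage_closure,
      mem_preimage] at h
    have h1 := closure_minimal subset_union_left hNc h.1
    have h2 := closure_minimal subset_union_left hNc' h.2
    refine skeleton_anti (le_max_right _ _) (h1.elim (fun h1 => h2.elim (fun h2 => ?_) id) id)
    exact (Set.disjoint_left.1 hUV (hNU h1) (hNV h2)).elim

theorem exists_disjoint_skeleton {A : Set QPinf} (hA : ShallowSet A) (α : QPinf ≃ₜ QPinf) :
    ∃ m, ∀ n ≥ m, ∀ x ∈ A, α x ∉ skeleton n := by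
  obtain ⟨n, U, hU, hne, hAU⟩ := hA
  have : ∀ i, ∃ m, ∀ k ≥ m, skeleton k ⊆ closure (α '' U i) := fun i =>
    exists_skeleton_subset_closure (α.isOpenMap _ (hU i)) ((hne i).image _)
  choose m hm using this
  refine ⟨Finset.univ.sup m, fun k hk x hx hxk => ?_⟩
  have : x ∈ A ∩ ⋂ i, closure (U i) := by
    refine ⟨hx, mem_iInter.2 fun i => ?_⟩
    have h := hm i k ((Finset.le_sup (Finset.mem_univ i)).trans hk) hxk
    rw [← α.image_closure] at h
    obtain ⟨z, hz, e⟩ := h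
    rwa [← α.injective e]
  rw [hAU] at this
  exact this

/-- Finitely many points of a skeleton can be moved to a smaller skeleton. -/
theorem exists_push {M M' : ℕ} {E : Set QPinf} (hE : E.Finite) :
    ∀ K : Set QPinf, (∀ S ⊆ K, IsClosed S) → Disjoint E K → E ⊆ skeleton M →
    ∃ g : QPinf ≃ₜ QPinf, (∀ z ∈ K, g z = z) ∧ (∀ z ∈ E, g z ∈ skeleton M') ∧
      ∀ C, DeterminedBy M C → ∀ z, g z ∈ C ↔ z ∈ C := by
  induction E, hE using Set.Finite.induction_on with
  | empty =>
    exact fun K _ _ _ => ⟨Homeomorph.refl _, fun _ _ => rfl, by simp, fun _ _ _ => Iff.rfl⟩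
  | @insert e E he hE ih =>
    intro K hK hd hM
    obtain ⟨g, hgK, hgE, hgC⟩ := ih (insert e K)
      (fun S hS => by
        by_cases heS : e ∈ S
        · rw [← insert_sdiff_self_of_mem heS]
          exact isClosed_singleton.union (hK _ (sdiff_singleton_subset_iff.2 hS))
        · exact hK _ ((subset_insert_iff_of_notMem heS).1 hS))
      (by
        rw [Set.disjoint_insert_right]
        exact ⟨he, hd.mono_left (subset_insert _ _)⟩)
      ((subset_insert _ _).trans hM)
    have hge : g e = e := hgK e (mem_insert _ _)
    obtain ⟨z, hz⟩ := skeleton_nonempty (max M M')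
    have hE' : (g '' E).Finite := hE.image g
    obtain ⟨w, hwO, hwz, hwC⟩ := exists_near (x := z) (O := (K \ {z} ∪ g '' E \ {z})ᶜ)
      ((hK _ sdiff_subset).union (hE'.subset sdiff_subset).isClosed).isOpen_compl (by simp)
      (max M M')
    have hw := (hwC _ (determinedBy_skeleton _)).1 hz
    have hO : IsOpen (K ∪ g '' E)ᶜ := ((hK _ Subset.rfl).union hE'.isClosed).isOpen_compl
    have heO : e ∈ (K ∪ g '' E)ᶜ := by
      rintro (h | ⟨e', he', h⟩)
      · exact Set.disjoint_left.1 hd (mem_insert _ _) h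
      · rw [← hge] at h
        exact he (g.injective h ▸ he')
    have hwO' : w ∈ (K ∪ g '' E)ᶜ := fun h => hwO (h.imp (fun h => ⟨h, hwz⟩) fun h => ⟨h, hwz⟩)
    obtain ⟨g', hg', hgs, hgC'⟩ := exists_swap_local hO hO heO hwO'
    have hfix : ∀ z ∈ K ∪ g '' E, g' z = z := fun z hz =>
      (hgs z).elim id fun h => (h.elim (fun h => h.1 hz) fun h => h.1 hz).elim
    refine ⟨g.trans g', fun z hz => ?_, ?_, fun C hC z => ?_⟩
    · simp [hgK z (mem_insert_of_mem _ hz), hfix z (Or.inl hz)]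
    · rintro z (rfl | hz)
      · simpa [hge, hg'] using skeleton_anti (le_max_right _ _) hw
      · simpa [hfix (g z) (Or.inr (mem_image_of_mem g hz))] using hgE z hz
    · exact (hgC' M (hM (mem_insert _ _)) (skeleton_anti (le_max_left _ _) hw) C hC _).trans
        (hgC C hC z)

variable {ι : Type}

/-- An injective family all of whose subfamilies have closed range. -/
def ClosedDiscrete (a : ι → QPinf) : Prop :=
  Function.Injective a ∧ ∀ S : Set ι, IsClosed (a '' S)

theorem ClosedDiscrete.comp {a : ι → QPinf} (ha : ClosedDiscrete a) (α : QPinf ≃ₜ QPinf) :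
    ClosedDiscrete (α ∘ a) := by
  refine ⟨α.injective.comp ha.1, fun S => ?_⟩
  rw [image_comp]
  exact α.isClosedMap _ (ha.2 S)

theorem ClosedDiscrete.exists_push {a : ι → QPinf} (ha : ClosedDiscrete a) {X : Set QPinf}
    (hX : X.Finite) (α : QPinf ≃ₜ QPinf) {M M' : ℕ} (hXM : ∀ x ∈ X, α x ∉ skeleton M)
    {D : Set ι} (hD : ∀ i ∈ D, α (a i) ∉ skeleton M') (hD' : ∀ i ∉ D, α (a i) ∈ skeleton M)
    (hfin : {i | i ∉ D ∧ α (a i) ∉ skeleton M'}.Finite) :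
    ∃ α' : QPinf ≃ₜ QPinf, (∀ x ∈ X, α' x = α x) ∧ (∀ i, α' (a i) ∈ skeleton M' ↔ i ∉ D) ∧
      ∀ C, DeterminedBy M C → ∀ z, α' z ∈ C ↔ α z ∈ C := by
  have hαa := ha.comp α
  set E := {i | i ∉ D ∧ α (a i) ∉ skeleton M'}
  obtain ⟨g, hgK, hgE, hgC⟩ := QPinf.exists_push (M := M) (M' := M')
    (hfin.image (α ∘ a)) (α '' X ∪ (α ∘ a) '' Eᶜ) (fun S hS => by
      rw [← inter_eq_left.2 hS, inter_union_distrib_left]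
      refine ((hX.image α).subset inter_subset_right).isClosed.union ?_
      obtain ⟨T, -, hT⟩ := subset_image_iff.1 (inter_subset_right (s := S) (t := (α ∘ a) '' Eᶜ))
      rw [← hT]
      exact hαa.2 T) (by
      rw [Set.disjoint_left]
      rintro _ ⟨i, hi, rfl⟩ (⟨x, hx, h⟩ | ⟨j, hj, h⟩)
      · exact hXM x hx (h ▸ hD' i hi.1)
      · exact hj (hαa.1 h ▸ hi)) (by
      rintro _ ⟨i, hi, rfl⟩
      exact hD' i hi.1)
  refine ⟨α.trans g, fun x hx => hgK _ (Or.inl (mem_image_of_mem _ hx)), fun i => ?_,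
    fun C hC z => hgC C hC _⟩
  by_cases hi : i ∈ E
  · exact iff_of_true (hgE _ (mem_image_of_mem _ hi)) hi.1
  · have h : g (α (a i)) = α (a i) := hgK _ (Or.inr (mem_image_of_mem (α ∘ a) hi))
    change g (α (a i)) ∈ _ ↔ _
    rw [h]
    refine ⟨fun h hiD => hD i hiD h, fun hiD => ?_⟩
    by_contra h
    exact hi ⟨hiD, h⟩

/-- An approximation of a homeomorphism sending `a` to `b`. -/
structure Approx (a b : ι → QPinf) where
  α : QPinf ≃ₜ QPinf
  β : QPinf ≃ₜ QPinf
  F : Set (QPinf × QPinf)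
  𝒞 : Set (Set QPinf)
  finite : F.Finite
  admissible : Admissible 𝒞
  eq_of_mem : ∀ p ∈ F, α p.1 = β p.2
  iff_of_mem : ∀ p ∈ F, ∀ i, p.1 = a i ↔ p.2 = b i
  mem_iff_mem : ∀ i, ∀ C ∈ 𝒞, α (a i) ∈ C ↔ β (b i) ∈ C

namespace Approx

variable {a b : ι → QPinf}

instance : Preorder (Approx a b) where
  le s t := s.F ⊆ t.F ∧ s.𝒞 ⊆ t.𝒞 ∧
    ∀ C ∈ s.𝒞, ∀ z, (t.α z ∈ C ↔ s.α z ∈ C) ∧ (t.β z ∈ C ↔ s.β z ∈ C)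
  le_refl s := ⟨Subset.rfl, Subset.rfl, fun _ _ _ => ⟨Iff.rfl, Iff.rfl⟩⟩
  le_trans s t u h h' := ⟨h.1.trans h'.1, h.2.1.trans h'.2.1, fun C hC z =>
    ⟨(h'.2.2 C (h.2.1 hC) z).1.trans (h.2.2 C hC z).1,
      (h'.2.2 C (h.2.1 hC) z).2.trans (h.2.2 C hC z).2⟩⟩

/-- The approximation with the two sides exchanged. -/
def flip (s : Approx a b) : Approx b a where
  α := s.β
  β := s.α
  F := Prod.swap ⁻¹' s.F
  𝒞 := s.𝒞
  finite := s.finite.preimage Prod.swap_injective.injOn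
  admissible := s.admissible
  eq_of_mem _ hp := (s.eq_of_mem _ hp).symm
  iff_of_mem _ hp i := (s.iff_of_mem _ hp i).symm
  mem_iff_mem i C hC := (s.mem_iff_mem i C hC).symm

theorem flip_le_flip {s t : Approx a b} (h : s ≤ t) : s.flip ≤ t.flip :=
  ⟨preimage_mono h.1, h.2.1, fun C hC z => (h.2.2 C hC z).symm⟩

theorem exists_assign (s : Approx a b) {x y : QPinf} (hx : ∀ p ∈ s.F, p.1 ≠ x)
    (hy : ∀ p ∈ s.F, p.2 ≠ y) (hxy : ∀ C ∈ s.𝒞, s.α x ∈ C ↔ s.β y ∈ C)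
    (hab : ∀ i, x = a i ↔ y = b i) : ∃ t ≥ s, (x, y) ∈ t.F := by
  obtain ⟨g, hg, hgK, hgC⟩ := exists_swap s.admissible (K := (fun p => s.α p.1) '' s.F)
    (s.finite.image _).isClosed (x := s.α x) (y := s.β y)
    (by
      rintro ⟨p, hp, h⟩
      exact hx p hp (s.α.injective h))
    (by
      rintro ⟨p, hp, h⟩
      exact hy p hp (s.β.injective ((s.eq_of_mem p hp).symm.trans h))) hxy
  refine ⟨⟨s.α.trans g, s.β, insert (x, y) s.F, s.𝒞, s.finite.insert _, s.admissible, ?_, ?_,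
    fun i C hC => (hgC C hC _).trans (s.mem_iff_mem i C hC)⟩,
    ⟨subset_insert _ _, Subset.rfl, fun C hC z => ⟨hgC C hC _, Iff.rfl⟩⟩, mem_insert _ _⟩
  · rintro p (rfl | hp)
    · exact hg
    · exact (hgK _ ⟨p, hp, rfl⟩).trans (s.eq_of_mem p hp)
  · rintro p (rfl | hp)
    · exact hab
    · exact s.iff_of_mem p hp

theorem exists_fst (ha : Function.Injective a) (hb : ClosedDiscrete b) (x : QPinf)
    (s : Approx a b) : ∃ t ≥ s, ∃ y, (x, y) ∈ t.F := by
  by_cases hx : ∀ p ∈ s.F, p.1 ≠ x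
  swap
  · push Not at hx
    obtain ⟨p, hp, rfl⟩ := hx
    exact ⟨s, le_rfl, p.2, hp⟩
  suffices ∃ y, (∀ p ∈ s.F, p.2 ≠ y) ∧ (∀ C ∈ s.𝒞, s.α x ∈ C ↔ s.β y ∈ C) ∧
      ∀ i, x = a i ↔ y = b i by
    obtain ⟨y, h1, h2, h3⟩ := this
    obtain ⟨t, hst, ht⟩ := s.exists_assign hx h1 h2 h3
    exact ⟨t, hst, y, ht⟩
  by_cases hxa : ∃ i, x = a i
  · obtain ⟨i, rfl⟩ := hxa
    exact ⟨b i, fun p hp h => hx p hp ((s.iff_of_mem p hp i).2 h), s.mem_iff_mem i,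
      fun j => by rw [ha.eq_iff, hb.1.eq_iff]⟩
  push Not at hxa
  by_cases hxb : ∃ j, s.β (b j) = s.α x
  · obtain ⟨j, hj⟩ := hxb
    obtain ⟨k, hk⟩ := s.admissible.exists_determinedBy
    obtain ⟨w, hwO, hw, hwC⟩ := exists_near (x := s.α x)
      (O := ((s.β ∘ b) '' {i | i ≠ j} ∪ (fun p => s.β p.2) '' s.F)ᶜ)
      (((hb.comp s.β).2 _).union (s.finite.image _).isClosed).isOpen_compl (by
        rintro (⟨i, hi, h⟩ | ⟨p, hp, h⟩)
        · exact hi (hb.1 (s.β.injective (h.trans hj.symm)))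
        · exact hx p hp (s.α.injective ((s.eq_of_mem p hp).trans h))) k
    refine ⟨s.β.symm w, fun q hq h => hwO (Or.inr ⟨q, hq, by simp [h]⟩), fun C hC => ?_,
      fun i => iff_of_false (hxa i) fun h => ?_⟩
    · simpa using hwC C (hk k le_rfl C hC)
    · have hi : s.β (b i) = w := by simp [← h]
      by_cases hij : i = j
      · exact hw (by rw [← hi, hij, hj])
      · exact hwO (Or.inl ⟨i, hij, hi⟩)
  · refine ⟨s.β.symm (s.α x), fun p hp h => hx p hp (s.α.injective ?_), fun C _ => by simp,
      fun i => iff_of_false (hxa i) fun h => hxb ⟨i, by simp [← h]⟩⟩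
    rw [s.eq_of_mem p hp, h, s.β.apply_symm_apply]

theorem exists_snd (ha : ClosedDiscrete a) (hb : Function.Injective b) (y : QPinf)
    (s : Approx a b) : ∃ t ≥ s, ∃ x, (x, y) ∈ t.F := by
  obtain ⟨t, hst, x, hx⟩ := exists_fst hb ha y s.flip
  exact ⟨t.flip, flip_le_flip hst, x, hx⟩

/-- The families `a` and `b` can be separated from the skeleta in the same way. -/
def Balanced (a b : ι → QPinf) : Prop :=
  ∀ (α β : QPinf ≃ₜ QPinf) (M M₀ : ℕ), ∃ M' ≥ M₀, ∃ D : Set ι,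
    (∀ i ∈ D, α (a i) ∉ skeleton M' ∧ β (b i) ∉ skeleton M') ∧
    (∀ i ∉ D, α (a i) ∈ skeleton M ∧ β (b i) ∈ skeleton M) ∧
    {i | i ∉ D ∧ α (a i) ∉ skeleton M'}.Finite ∧ {i | i ∉ D ∧ β (b i) ∉ skeleton M'}.Finite

theorem exists_nhds (ha : ClosedDiscrete a) (hb : ClosedDiscrete b) (hab : Balanced a b)
    (s : Approx a b) {p : QPinf × QPinf} (hp : p ∈ s.F) {O O' : Set QPinf} (hO : IsOpen O)
    (hO' : IsOpen O') (hpO : p.1 ∈ O) (hpO' : p.2 ∈ O') :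
    ∃ t ≥ s, ∃ V ∈ t.𝒞, IsOpen V ∧ t.α p.1 ∈ V ∧ t.α ⁻¹' V ⊆ O ∧ t.β ⁻¹' V ⊆ O' := by
  have hpe := s.eq_of_mem p hp
  let W : Set QPinf := (s.α '' O ∩ s.β '' O') ∩
    ((s.α ∘ a) '' {i | p.1 ≠ a i} ∪ (s.β ∘ b) '' {i | p.1 ≠ a i})ᶜ
  have hW : IsOpen W := ((s.α.isOpenMap _ hO).inter (s.β.isOpenMap _ hO')).inter
    (((ha.comp s.α).2 _).union ((hb.comp s.β).2 _)).isOpen_compl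
  have hpW : s.α p.1 ∈ W := by
    refine ⟨⟨mem_image_of_mem _ hpO, hpe ▸ mem_image_of_mem _ hpO'⟩, ?_⟩
    rintro (⟨i, hi, h⟩ | ⟨i, hi, h⟩)
    · exact hi (s.α.injective h).symm
    · exact hi ((s.iff_of_mem p hp i).2 (s.β.injective (h.trans hpe)).symm)
  obtain ⟨k, hk⟩ := s.admissible.exists_determinedBy
  obtain ⟨n, hn⟩ := exists_forall_notMem_skeleton (s.finite.image fun p => s.α p.1)
  obtain ⟨l, hl⟩ := exists_nhds_determined hW hpW
  let M := max (max k n) l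
  obtain ⟨N, hNW, hpN, hN, -, hNM⟩ := hl M (le_max_right _ _)
  obtain ⟨M₀, hM₀⟩ := exists_nhds_determined hN hpN
  obtain ⟨M', hM', D, hD, hD', hf, hf'⟩ := hab s.α s.β M M₀
  obtain ⟨V, hVN, hpV, hV, hVc, hVM⟩ := hM₀ M' hM'
  have hnM : n ≤ M := (le_max_right k n).trans (le_max_left _ _)
  obtain ⟨α, hαX, hαD, hαC⟩ := ha.exists_push (s.finite.image Prod.fst) s.α (M := M) (by
    rintro _ ⟨q, hq, rfl⟩
    exact hn M hnM _ ⟨q, hq, rfl⟩) (fun i hi => (hD i hi).1) (fun i hi => (hD' i hi).1) hf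
  obtain ⟨β, hβX, hβD, hβC⟩ := hb.exists_push (s.finite.image Prod.snd) s.β (M := M) (by
    rintro _ ⟨q, hq, rfl⟩
    exact hn M hnM _ ⟨q, hq, s.eq_of_mem q hq⟩) (fun i hi => (hD i hi).2)
    (fun i hi => (hD' i hi).2) hf'
  have hα : ∀ q ∈ s.F, α q.1 = s.α q.1 := fun q hq => hαX _ ⟨q, hq, rfl⟩
  have hβ : ∀ q ∈ s.F, β q.2 = s.β q.2 := fun q hq => hβX _ ⟨q, hq, rfl⟩
  have hαV : ∀ z, α z ∈ V → s.α z ∈ W := fun z hz => hNW ((hαC N hNM z).1 (hVN hz))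
  have hβV : ∀ z, β z ∈ V → s.β z ∈ W := fun z hz => hNW ((hβC N hNM z).1 (hVN hz))
  have hpα : α p.1 ∈ V := by rwa [hα p hp]
  have hpβ : β p.2 ∈ V := by rwa [hβ p hp, ← hpe]
  have hC : ∀ C ∈ s.𝒞, DeterminedBy M C := hk M ((le_max_left k n).trans (le_max_left _ _))
  have hfr : frontier V ⊆ skeleton M' := frontier_subset_of_isClosed_union hV hVc
  refine ⟨⟨α, β, s.F, insert V (insert (skeleton M') s.𝒞), s.finite,
    s.admissible.insert_skeleton hVM hfr, fun q hq => ?_, s.iff_of_mem, ?_⟩,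
    ⟨Subset.rfl, (subset_insert _ _).trans (subset_insert _ _), fun C h z =>
      ⟨hαC C (hC C h) z, hβC C (hC C h) z⟩⟩, V, mem_insert _ _, hV, hpα, fun z hz => ?_,
    fun z hz => ?_⟩
  · rw [hα q hq, hβ q hq, s.eq_of_mem q hq]
  · rintro i C (rfl | rfl | h)
    · constructor
      · intro h
        by_cases hi : p.1 = a i
        · rwa [← (s.iff_of_mem p hp i).1 hi]
        · exact ((hαV _ h).2 (Or.inl ⟨i, hi, rfl⟩)).elim
      · intro h
        by_cases hi : p.1 = a i
        · rwa [← hi]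
        · exact ((hβV _ h).2 (Or.inr ⟨i, hi, rfl⟩)).elim
    · rw [hαD, hβD]
    · rw [hαC C (hC C h), hβC C (hC C h)]
      exact s.mem_iff_mem i C h
  · exact s.α.injective.mem_set_image.1 (hαV z hz).1.1
  · exact s.β.injective.mem_set_image.1 (hβV z hz).1.2

end Approx

theorem isOpenMap_mk : IsOpenMap mk := by
  intro U hU
  let σ : {l : ℚ // l ≠ 0} → ProjPoint ℚ → ProjPoint ℚ := fun l v =>
    ⟨l.1 • v.1, v.2.1.subset fun i hi => by simp_all, smul_ne_zero l.2 v.2.2⟩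
  have hσ : ∀ l, Continuous (σ l) := fun l => (continuous_subtype_val.const_smul l.1).subtype_mk _
  have : mk ⁻¹' (mk '' U) = ⋃ l, σ l ⁻¹' U := by
    ext v
    simp only [mem_preimage, mem_image, mem_iUnion]
    constructor
    · rintro ⟨u, hu, h⟩
      obtain ⟨l, hl, e⟩ := mk_eq_mk.1 h
      exact ⟨⟨l, hl⟩, by rwa [← show u = σ ⟨l, hl⟩ v from Subtype.ext e]⟩
    · rintro ⟨l, hl⟩
      exact ⟨_, hl, mk_eq_mk.2 ⟨l, l.2, rfl⟩⟩
  rw [isOpen_iff, this]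
  exact isOpen_iUnion fun l => hU.preimage (hσ l)

instance : SecondCountableTopology QPinf := by
  have : SecondCountableTopology ℚ := UniformSpace.secondCountable_of_separable ℚ
  have : SecondCountableTopology (ProjPoint ℚ) :=
    IsInducing.subtypeVal.secondCountableTopology
  exact Quotient.secondCountableTopology isOpenMap_mk

theorem exists_homeomorph {a b : ι → QPinf} (ha : ClosedDiscrete a) (hb : ClosedDiscrete b)
    (hab : Approx.Balanced a b) : ∃ h : QPinf ≃ₜ QPinf, ∀ i, h (a i) = b i := by
  let 𝓑 := countableBasis QPinf
  let 𝒟 : (QPinf × 𝓑 × 𝓑) ⊕ QPinf → Order.Cofinal (Approx a b) := Sum.elim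
    (fun q => ⟨{s | ∃ y, (q.1, y) ∈ s.F ∧ (q.1 ∈ q.2.1.1 → y ∈ q.2.2.1 → ∃ V ∈ s.𝒞, IsOpen V ∧
        s.α q.1 ∈ V ∧ s.α ⁻¹' V ⊆ q.2.1.1 ∧ s.β ⁻¹' V ⊆ q.2.2.1)}, fun s => by
      obtain ⟨t, hst, y, hy⟩ := Approx.exists_fst ha.1 hb q.1 s
      by_cases h : q.1 ∈ q.2.1.1 ∧ y ∈ q.2.2.1
      · obtain ⟨u, htu, hu⟩ := t.exists_nhds ha hb hab hy (isOpen_of_mem_countableBasis q.2.1.2)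
          (isOpen_of_mem_countableBasis q.2.2.2) h.1 h.2
        exact ⟨u, ⟨y, htu.1 hy, fun _ _ => hu⟩, hst.trans htu⟩
      · exact ⟨t, ⟨y, hy, fun h1 h2 => absurd ⟨h1, h2⟩ h⟩, hst⟩⟩)
    (fun y => ⟨{s | ∃ x, (x, y) ∈ s.F}, fun s => by
      obtain ⟨t, hst, ht⟩ := Approx.exists_snd ha hb.1 y s
      exact ⟨t, ht, hst⟩⟩)
  let : Encodable ((QPinf × 𝓑 × 𝓑) ⊕ QPinf) := Encodable.ofCountable _
  let s₀ : Approx a b := ⟨.refl _, .refl _, ∅, ∅, finite_empty, ⟨finite_empty, by simp⟩, by simp,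
    by simp, by simp⟩
  let I := Order.idealOfCofinals s₀ 𝒟
  have hI : ∀ i, ∃ s, s ∈ 𝒟 i ∧ s ∈ I := Order.cofinal_meets_idealOfCofinals s₀ 𝒟
  let R : QPinf → QPinf → Prop := fun x y => ∃ s ∈ I, (x, y) ∈ s.F
  have hR : ∀ {x y x' y'}, R x y → R x' y' → (x = x' ↔ y = y') := by
    rintro x y x' y' ⟨s, hs, h⟩ ⟨t, ht, h'⟩
    obtain ⟨u, -, hsu, htu⟩ := I.directed s hs t ht
    rw [← u.α.injective.eq_iff, u.eq_of_mem _ (hsu.1 h), u.eq_of_mem _ (htu.1 h'),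
      u.β.injective.eq_iff]
  have hRa : ∀ {x y}, R x y → ∀ i, x = a i ↔ y = b i := by
    rintro x y ⟨s, -, h⟩
    exact s.iff_of_mem _ h
  have hRV : ∀ s ∈ I, ∀ V ∈ s.𝒞, ∀ {x y}, R x y → (s.α x ∈ V ↔ s.β y ∈ V) := by
    rintro s hs V hV x y ⟨t, ht, h⟩
    obtain ⟨u, -, hsu, htu⟩ := I.directed s hs t ht
    rw [← (hsu.2.2 V hV x).1, ← (hsu.2.2 V hV y).2, u.eq_of_mem _ (htu.1 h)]
  have hRn : ∀ {x y}, R x y → ∀ O O', IsOpen O → IsOpen O' → x ∈ O → y ∈ O' → ∃ s ∈ I, ∃ V ∈ s.𝒞,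
      IsOpen V ∧ s.α x ∈ V ∧ s.α ⁻¹' V ⊆ O ∧ s.β ⁻¹' V ⊆ O' := by
    intro x y hxy O O' hO hO' hx hy
    obtain ⟨U, hU, hxU, hUO⟩ := (isBasis_countableBasis QPinf).exists_subset_of_mem_open hx hO
    obtain ⟨U', hU', hyU', hUO'⟩ := (isBasis_countableBasis QPinf).exists_subset_of_mem_open hy hO'
    obtain ⟨s, ⟨y', hy', h⟩, hs⟩ := hI (.inl (x, ⟨U, hU⟩, ⟨U', hU'⟩))
    obtain rfl : y = y' := (hR hxy ⟨s, hs, hy'⟩).1 rfl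
    obtain ⟨V, hV, hVo, hxV, h1, h2⟩ := h hxU hyU'
    exact ⟨s, hs, V, hV, hVo, hxV, h1.trans hUO, h2.trans hUO'⟩
  have hfst : ∀ x, ∃ y, R x y := by
    intro x
    obtain ⟨U, hU, -⟩ := (isBasis_countableBasis QPinf).exists_subset_of_mem_open (mem_univ x)
      isOpen_univ
    obtain ⟨s, ⟨y, hy, -⟩, hs⟩ := hI (.inl (x, ⟨U, hU⟩, ⟨U, hU⟩))
    exact ⟨y, s, hs, hy⟩
  have hsnd : ∀ y, ∃ x, R x y := by
    intro y
    obtain ⟨s, ⟨x, hx⟩, hs⟩ := hI (.inr y)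
    exact ⟨x, s, hs, hx⟩
  choose h hh using hfst
  choose k hk using hsnd
  refine ⟨⟨⟨h, k, fun x => (hR (hk _) (hh x)).2 rfl, fun y => (hR (hh _) (hk y)).1 rfl⟩, ?_, ?_⟩,
    fun i => (hRa (hh (a i)) i).1 rfl⟩
  · refine continuous_iff_continuousAt.2 fun x => tendsto_nhds.2 fun O hO hxO => ?_
    obtain ⟨s, hs, V, hV, hVo, hxV, -, hVO⟩ := hRn (hh x) univ O isOpen_univ hO (mem_univ _) hxO
    exact Filter.mem_of_superset ((hVo.preimage s.α.continuous).mem_nhds hxV) fun z hz =>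
      hVO (mem_preimage.2 ((hRV s hs V hV (hh z)).1 hz))
  · refine continuous_iff_continuousAt.2 fun y => tendsto_nhds.2 fun O hO hyO => ?_
    obtain ⟨s, hs, V, hV, hVo, hxV, hVO, -⟩ := hRn (hk y) O univ hO isOpen_univ hyO (mem_univ _)
    exact Filter.mem_of_superset ((hVo.preimage s.β.continuous).mem_nhds
      ((hRV s hs V hV (hk y)).1 hxV)) fun z hz => hVO (mem_preimage.2 ((hRV s hs V hV (hk z)).2 hz))

theorem closedDiscrete_of_range_eq {a : ι → QPinf} (ha : Function.Injective a) {A : Set QPinf}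
    (hA : range a = A) (hAc : IsClosed A) (hAd : DiscreteTopology ↥A) : ClosedDiscrete a := by
  refine ⟨ha, fun S => ?_⟩
  have h : a '' S ⊆ A := hA ▸ image_subset_range a S
  rw [← inter_eq_right.2 h, ← Subtype.image_preimage_coe]
  exact hAc.isClosedEmbedding_subtypeVal.isClosedMap _ (isClosed_discrete _)

theorem balanced_of_deepSet {a b : ι → QPinf} (ha : Function.Injective a)
    (hb : Function.Injective b) (hA : DeepSet (range a)) (hB : DeepSet (range b)) :
    Approx.Balanced a b := by
  intro α β M M₀
  have hfa : ∀ m, {i | α (a i) ∉ skeleton m}.Finite := fun m =>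
    ((finite_notMem_skeleton hA α m).preimage ha.injOn).subset fun i hi => ⟨mem_range_self i, hi⟩
  have hfb : ∀ m, {i | β (b i) ∉ skeleton m}.Finite := fun m =>
    ((finite_notMem_skeleton hB β m).preimage hb.injOn).subset fun i hi => ⟨mem_range_self i, hi⟩
  have hD := (hfa M).union (hfb M)
  obtain ⟨n, hn⟩ := exists_forall_notMem_skeleton (hD.image (α ∘ a))
  obtain ⟨n', hn'⟩ := exists_forall_notMem_skeleton (hD.image (β ∘ b))
  refine ⟨max (max n n') M₀, le_max_right _ _, _, fun i hi =>
    ⟨hn _ (by omega) _ (mem_image_of_mem _ hi), hn' _ (by omega) _ (mem_image_of_mem _ hi)⟩,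
    fun i hi => ?_, (hfa _).subset fun i hi => hi.2, (hfb _).subset fun i hi => hi.2⟩
  simpa [not_or] using hi

theorem balanced_of_shallowSet {a b : ι → QPinf} (hA : ShallowSet (range a))
    (hB : ShallowSet (range b)) : Approx.Balanced a b := by
  intro α β M M₀
  obtain ⟨n, hn⟩ := exists_disjoint_skeleton hA α
  obtain ⟨n', hn'⟩ := exists_disjoint_skeleton hB β
  exact ⟨max (max n n') M₀, le_max_right _ _, univ, fun i _ =>
    ⟨hn _ (by omega) _ (mem_range_self i), hn' _ (by omega) _ (mem_range_self i)⟩, by simp, by simp,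
    by simp⟩

end QPinf

/-- dichotomic homogeneity of ℚP^∞. -/
theorem dichotomic_homogeneity_QPinf (A B : Set QPinf)
    (hAc : IsClosed A) (hBc : IsClosed B)
    (hAd : DiscreteTopology ↥A) (hBd : DiscreteTopology ↥B)
    (hdeep : (DeepSet A ∧ DeepSet B) ∨ (ShallowSet A ∧ ShallowSet B))
    (f : ↥A → ↥B) (hf : Function.Bijective f) :
    ∃ h : QPinf ≃ₜ QPinf, (∀ a : ↥A, h a = (f a : QPinf)) ∧ ⇑h '' A = B := by
  have ha : range (Subtype.val : A → QPinf) = A := Subtype.range_coe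
  have hb : range (Subtype.val ∘ f : A → QPinf) = B := by
    rw [hf.2.range_comp, Subtype.range_coe]
  have hbi : Function.Injective (Subtype.val ∘ f) := Subtype.val_injective.comp hf.1
  obtain ⟨h, hh⟩ := QPinf.exists_homeomorph
    (QPinf.closedDiscrete_of_range_eq Subtype.val_injective ha hAc hAd)
    (QPinf.closedDiscrete_of_range_eq hbi hb hBc hBd) (hdeep.elim
      (fun H => QPinf.balanced_of_deepSet Subtype.val_injective hbi (ha.symm ▸ H.1) (hb.symm ▸ H.2))
      fun H => QPinf.balanced_of_shallowSet (ha.symm ▸ H.1) (hb.symm ▸ H.2))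
  refine ⟨h, hh, ?_⟩
  rw [← hb]
  nth_rw 1 [← ha]
  rw [← range_comp]
  exact congrArg range (funext hh)
end

section
/- Any bijective function f : A → B between two finite subsets A, B of the infinite rational projective space ℚP^∞ can be extended to a homeomorphism of ℚP^∞ onto itself. -/
open Set Topology TopologicalSpace

/-- A homogeneous homeomorphism of the sequence space that preserves finite supports descends to
the projective space. -/
theorem exists_homeomorph_of_homogeneous (S T : (ℕ → ℚ) → ℕ → ℚ)
    (hS : Continuous S) (hT : Continuous T)
    (hSl : ∀ (l : ℚ) x, S (l • x) = l • S x) (hTl : ∀ (l : ℚ) x, T (l • x) = l • T x)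
    (hST : ∀ x, S (T x) = x) (hTS : ∀ x, T (S x) = x)
    (hSf : ∀ x, {n | x n ≠ 0}.Finite → {n | S x n ≠ 0}.Finite)
    (hTf : ∀ x, {n | x n ≠ 0}.Finite → {n | T x n ≠ 0}.Finite) :
    ∃ h : QPinf ≃ₜ QPinf, ∀ x : ProjPoint ℚ, ∃ y : ProjPoint ℚ,
      (y : ℕ → ℚ) = S x ∧ h (Quotient.mk _ x) = Quotient.mk _ y := by
  have hS0 : S 0 = 0 := by simpa using hSl 0 0
  have hT0 : T 0 = 0 := by simpa using hTl 0 0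
  let S' : ProjPoint ℚ → ProjPoint ℚ := fun x => ⟨S x, hSf _ x.2.1, fun h => x.2.2 (by
    rw [← hTS x.1, h, hT0])⟩
  let T' : ProjPoint ℚ → ProjPoint ℚ := fun x => ⟨T x, hTf _ x.2.1, fun h => x.2.2 (by
    rw [← hST x.1, h, hS0])⟩
  have hS' : Continuous S' := (hS.comp continuous_subtype_val).subtype_mk _
  have hT' : Continuous T' := (hT.comp continuous_subtype_val).subtype_mk _
  have hSr : ∀ a b, (projSetoid ℚ).r a b → (projSetoid ℚ).r (S' a) (S' b) := by
    rintro a b ⟨l, hl, h⟩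
    exact ⟨l, hl, by simp only [S', h, hSl]⟩
  have hTr : ∀ a b, (projSetoid ℚ).r a b → (projSetoid ℚ).r (T' a) (T' b) := by
    rintro a b ⟨l, hl, h⟩
    exact ⟨l, hl, by simp only [T', h, hTl]⟩
  refine ⟨⟨⟨Quotient.map S' hSr, Quotient.map T' hTr, ?_, ?_⟩,
    hS'.quotient_map' hSr, hT'.quotient_map' hTr⟩, fun x => ⟨S' x, rfl, rfl⟩⟩
  · rintro ⟨x⟩
    exact congrArg (Quotient.mk _) (Subtype.ext (hTS x))
  · rintro ⟨x⟩
    exact congrArg (Quotient.mk _) (Subtype.ext (hST x))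

/-- A homogeneous shear `x ↦ x + G x` descends to a homeomorphism of the projective space. -/
theorem exists_homeomorph_of_shear (G : (ℕ → ℚ) → ℕ → ℚ) (hG : Continuous G)
    (hGl : ∀ (l : ℚ) x, G (l • x) = l • G x) (hGadd : ∀ x y, G (x + G y) = G x)
    (hGf : ∀ x, {n | G x n ≠ 0}.Finite) :
    ∃ h : QPinf ≃ₜ QPinf, ∀ x : ProjPoint ℚ, ∃ y : ProjPoint ℚ,
      (y : ℕ → ℚ) = x + G x ∧ h (Quotient.mk _ x) = Quotient.mk _ y := by
  have hGsub : ∀ x y, G (x - G y) = G x := fun x y => by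
    have := hGadd x ((-1 : ℚ) • y)
    rwa [hGl, neg_one_smul, ← sub_eq_add_neg] at this
  refine exists_homeomorph_of_homogeneous (fun x => x + G x) (fun x => x - G x)
    (continuous_id.add hG) (continuous_id.sub hG) ?_ ?_ ?_ ?_ ?_ ?_
  · intro l x
    simp only [hGl, smul_add]
  · intro l x
    simp only [hGl, smul_sub]
  · intro x
    simp only [hGsub, sub_add_cancel]
  · intro x
    simp only [hGadd, add_sub_cancel_right]
  · refine fun x hx => (hx.union (hGf x)).subset fun n hn => ?_
    by_contra! h
    simp_all
  · refine fun x hx => (hx.union (hGf x)).subset fun n hn => ?_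
    by_contra! h
    simp_all

/-- The scalar product of the first `n` coordinates. -/
def dotBelow (n : ℕ) (x y : ℕ → ℚ) : ℚ := ∑ m ∈ Finset.range n, x m * y m

theorem dotBelow_smul_left (n : ℕ) (l : ℚ) (x y : ℕ → ℚ) :
    dotBelow n (l • x) y = l * dotBelow n x y := by
  simp [dotBelow, Finset.mul_sum, mul_assoc]

theorem dotBelow_smul_right (n : ℕ) (l : ℚ) (x y : ℕ → ℚ) :
    dotBelow n x (l • y) = l * dotBelow n x y := by
  simp [dotBelow, Finset.mul_sum, mul_left_comm]

theorem dotBelow_self_nonneg (n : ℕ) (x : ℕ → ℚ) : 0 ≤ dotBelow n x x :=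
  Finset.sum_nonneg fun _ _ => mul_self_nonneg _

theorem dotBelow_self_eq_zero {n : ℕ} {x : ℕ → ℚ} :
    dotBelow n x x = 0 ↔ ∀ m < n, x m = 0 := by
  rw [dotBelow, Finset.sum_eq_zero_iff_of_nonneg fun _ _ => mul_self_nonneg _]
  simp

theorem dotBelow_congr_left {n : ℕ} {x x' : ℕ → ℚ} (h : ∀ m < n, x m = x' m) (y : ℕ → ℚ) :
    dotBelow n x y = dotBelow n x' y :=
  Finset.sum_congr rfl fun m hm => by rw [h m (Finset.mem_range.1 hm)]

theorem dotBelow_comm (n : ℕ) (x y : ℕ → ℚ) : dotBelow n x y = dotBelow n y x :=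
  Finset.sum_congr rfl fun _ _ => mul_comm _ _

theorem dotBelow_sq_le (n : ℕ) (x y : ℕ → ℚ) :
    dotBelow n x y ^ 2 ≤ dotBelow n x x * dotBelow n y y := by
  simpa only [dotBelow, ← sq] using Finset.sum_mul_sq_le_sq_mul_sq (Finset.range n) x y

theorem continuous_dotBelow {n : ℕ} {f g : (ℕ → ℚ) → ℕ → ℚ} (hf : Continuous f)
    (hg : Continuous g) : Continuous fun x => dotBelow n (f x) (g x) :=
  continuous_finsetSum _ fun m _ =>
    ((continuous_apply m).comp hf).mul ((continuous_apply m).comp hg)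

/-- The squared distance from `a` to the line spanned by `x`, in the first `n` coordinates. -/
def sqDistLine (n : ℕ) (a x : ℕ → ℚ) : ℚ :=
  dotBelow n a a - dotBelow n x a ^ 2 / dotBelow n x x

theorem sqDistLine_smul (n : ℕ) (a : ℕ → ℚ) {l : ℚ} (hl : l ≠ 0) (x : ℕ → ℚ) :
    sqDistLine n a (l • x) = sqDistLine n a x := by
  rw [sqDistLine, sqDistLine, dotBelow_smul_left, dotBelow_smul_left, dotBelow_smul_right,
    mul_pow, ← mul_assoc, ← sq, mul_div_mul_left _ _ (pow_ne_zero 2 hl)]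

theorem sqDistLine_congr {n : ℕ} {x x' : ℕ → ℚ} (h : ∀ m < n, x m = x' m) (a : ℕ → ℚ) :
    sqDistLine n a x = sqDistLine n a x' := by
  rw [sqDistLine, sqDistLine, dotBelow_congr_left h, dotBelow_congr_left h, dotBelow_comm n x' x,
    dotBelow_congr_left h]

theorem abs_sqDistLine_le (n : ℕ) (a x : ℕ → ℚ) : |sqDistLine n a x| ≤ dotBelow n a a := by
  have h1 : dotBelow n x a ^ 2 / dotBelow n x x ≤ dotBelow n a a :=
    div_le_of_le_mul₀ (dotBelow_self_nonneg n x) (dotBelow_self_nonneg n a)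
      ((dotBelow_sq_le n x a).trans_eq (mul_comm _ _))
  have h2 : 0 ≤ dotBelow n x a ^ 2 / dotBelow n x x :=
    div_nonneg (sq_nonneg _) (dotBelow_self_nonneg n x)
  rw [sqDistLine, abs_of_nonneg (sub_nonneg.2 h1)]
  linarith

theorem sqDistLine_self (n : ℕ) (a : ℕ → ℚ) : sqDistLine n a a = 0 := by
  rw [sqDistLine, sq, mul_self_div_self, sub_self]

theorem eq_smul_of_sqDistLine_eq_zero {n : ℕ} {a x : ℕ → ℚ} (hx : dotBelow n x x ≠ 0)
    (h : sqDistLine n a x = 0) : ∀ m < n, a m = dotBelow n x a / dotBelow n x x * x m := by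
  set t := dotBelow n x a / dotBelow n x x with ht
  have key : dotBelow n (a - t • x) (a - t • x) = 0 := by
    have e : dotBelow n (a - t • x) (a - t • x)
        = dotBelow n a a - 2 * t * dotBelow n x a + t ^ 2 * dotBelow n x x := by
      simp only [dotBelow, Finset.mul_sum, ← Finset.sum_sub_distrib, ← Finset.sum_add_distrib]
      refine Finset.sum_congr rfl fun m _ => ?_
      simp only [Pi.sub_apply, Pi.smul_apply, smul_eq_mul]
      ring
    rw [e, ← h, sqDistLine, ht]
    field_simp
    ring
  intro m hm
  have := dotBelow_self_eq_zero.1 key m hm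
  simpa [sub_eq_zero] using this

theorem continuous_sqDistLine_mul (n : ℕ) (a : ℕ → ℚ) {g : (ℕ → ℚ) → ℚ} (hg : Continuous g)
    (hg0 : ∀ x, dotBelow n x x = 0 → g x = 0) :
    Continuous fun x => sqDistLine n a x * g x := by
  have hN : Continuous fun x => dotBelow n x x := continuous_dotBelow continuous_id continuous_id
  have hD : Continuous fun x => dotBelow n x a := continuous_dotBelow continuous_id continuous_const
  rw [continuous_iff_continuousAt]
  intro p
  by_cases hp : dotBelow n p p = 0
  · have hgp := hg.tendsto p
    rw [hg0 p hp] at hgp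
    rw [ContinuousAt, hg0 p hp, mul_zero]
    exact bdd_le_mul_tendsto_zero' (dotBelow n a a)
      (Filter.Eventually.of_forall (abs_sqDistLine_le n a)) hgp
  · exact (continuousAt_const.sub ((hD.continuousAt.pow 2).div hN.continuousAt hp)).mul
      hg.continuousAt

theorem continuous_prod_sqDistLine_mul {ι : Type*} (n : ℕ) (a : ι → ℕ → ℚ) (s : Finset ι)
    {g : (ℕ → ℚ) → ℚ} (hg : Continuous g) (hg0 : ∀ x, dotBelow n x x = 0 → g x = 0) :
    Continuous fun x => (∏ i ∈ s, sqDistLine n (a i) x) * g x := by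
  classical
  induction s using Finset.induction_on with
  | empty => simpa using hg
  | insert i s hi ih =>
    simp only [Finset.prod_insert hi, mul_assoc]
    exact continuous_sqDistLine_mul n (a i) ih fun x hx => by rw [hg0 x hx, mul_zero]

/-- Finitely many distinct points of the projective space, supported below `n`, can be moved to
prescribed distinct coordinate points with indices at least `n`. -/
theorem exists_homeomorph_to_coordinate_points {ι : Type*} [Finite ι] (x : ι → ProjPoint ℚ)
    (hx : Function.Injective fun i => (Quotient.mk _ (x i) : QPinf)) (n : ℕ)
    (hn : ∀ i m, n ≤ m → (x i : ℕ → ℚ) m = 0) (e : ι → ℕ) (he : Function.Injective e)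
    (hen : ∀ i, n ≤ e i) :
    ∃ h : QPinf ≃ₜ QPinf, ∀ i, ∀ y : ProjPoint ℚ, (y : ℕ → ℚ) = Pi.single (e i) 1 →
      h (Quotient.mk _ (x i)) = Quotient.mk _ y := by
  classical
  have := Fintype.ofFinite ι
  have hN : ∀ i, dotBelow n (x i) (x i) ≠ 0 := fun i h => (x i).2.2 <| funext fun m => by
    rcases lt_or_ge m n with hm | hm
    · exact dotBelow_self_eq_zero.1 h m hm
    · exact hn i m hm
  let g : ι → (ℕ → ℚ) → ℚ := fun j z =>
    (∏ i ∈ Finset.univ.erase j, sqDistLine n (x i) z) * dotBelow n z (x j)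
  have hgc : ∀ j, Continuous (g j) := fun j =>
    continuous_prod_sqDistLine_mul n (fun i => (x i : ℕ → ℚ)) _
      (continuous_dotBelow continuous_id continuous_const) fun z hz => by
        have := dotBelow_sq_le n z (x j)
        rw [hz, zero_mul] at this
        exact pow_eq_zero_iff two_ne_zero |>.1 (this.antisymm (sq_nonneg _))
  have hgl : ∀ j (l : ℚ) z, g j (l • z) = l * g j z := by
    intro j l z
    rcases eq_or_ne l 0 with rfl | hl
    · simp [g, dotBelow]
    · simp only [g, sqDistLine_smul n _ hl, dotBelow_smul_left]
      ring
  have hgcongr : ∀ j z z', (∀ m < n, z m = z' m) → g j z = g j z' := fun j z z' h => by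
    simp only [g, sqDistLine_congr h, dotBelow_congr_left h]
  have hgne : ∀ i j, i ≠ j → g j (x i) = 0 := fun i j hij =>
    mul_eq_zero_of_left (Finset.prod_eq_zero (Finset.mem_erase.2 ⟨hij, Finset.mem_univ i⟩)
      (sqDistLine_self n _)) _
  have hgself : ∀ j, g j (x j) ≠ 0 := by
    refine fun j => mul_ne_zero (Finset.prod_ne_zero_iff.2 fun i hi h => ?_) (hN j)
    refine (Finset.mem_erase.1 hi).1 (hx (Quotient.sound ?_))
    have hm := eq_smul_of_sqDistLine_eq_zero (hN j) h
    have hfun : (x i : ℕ → ℚ) =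
        (dotBelow n (x j) (x i) / dotBelow n (x j) (x j)) • (x j : ℕ → ℚ) := by
      funext m
      rcases lt_or_ge m n with h' | h'
      · exact hm m h'
      · simp [hn _ m h']
    exact ⟨_, fun h0 => (x i).2.2 (by rw [hfun, h0, zero_smul]), hfun⟩
  obtain ⟨h₁, hh₁⟩ := exists_homeomorph_of_shear
    (fun z => ∑ j, g j z • (Pi.single (e j) 1 : ℕ → ℚ))
    (continuous_finsetSum _ fun j _ => (hgc j).smul continuous_const)
    (fun l z => by simp only [hgl, Finset.smul_sum, mul_smul])
    (fun z w => Finset.sum_congr rfl fun j _ => by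
      rw [hgcongr j _ z fun m hm => ?_]
      simp only [Pi.add_apply, Finset.sum_apply, Pi.smul_apply, smul_eq_mul, add_eq_left]
      refine Finset.sum_eq_zero fun i _ => ?_
      rw [Pi.single_eq_of_ne (hm.trans_le (hen i)).ne, mul_zero])
    (fun z => (Set.finite_range e).subset fun m hm => by
      by_contra hme
      refine hm ?_
      simp only [Finset.sum_apply, Pi.smul_apply, smul_eq_mul]
      refine Finset.sum_eq_zero fun i _ => ?_
      rw [Pi.single_eq_of_ne fun h => hme ⟨i, h.symm⟩, mul_zero])
  obtain ⟨h₂, hh₂⟩ := exists_homeomorph_of_shear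
    (fun z => ∑ j, (-(z (e j) / g j (x j))) • (x j : ℕ → ℚ))
    (continuous_finsetSum _ fun j _ =>
      (((continuous_apply (e j)).div_const _).neg).smul continuous_const)
    (fun l z => by
      simp only [Finset.smul_sum, smul_smul, Pi.smul_apply, smul_eq_mul, mul_neg, mul_div_assoc])
    (fun z w => Finset.sum_congr rfl fun j _ => by
      simp [Finset.sum_apply, hn _ _ (hen j)])
    (fun z => (Set.finite_lt_nat n).subset fun m hm => by
      by_contra hmn
      refine hm ?_
      simp [Finset.sum_apply, hn _ _ (not_lt.1 hmn)])
  refine ⟨h₁.trans h₂, fun i y hy => ?_⟩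
  obtain ⟨u, hu, hu'⟩ := hh₁ (x i)
  obtain ⟨v, hv, hv'⟩ := hh₂ u
  rw [Homeomorph.trans_apply, hu', hv']
  rw [Finset.sum_eq_single i (fun j _ hj => by rw [hgne i j hj.symm, zero_smul]) (by simp)] at hu
  have hue : ∀ j, j ≠ i → (u : ℕ → ℚ) (e j) = 0 := fun j hj => by
    simp [hu, hn _ _ (hen j), Pi.single_eq_of_ne (he.ne hj)]
  have huei : (u : ℕ → ℚ) (e i) = g i (x i) := by
    simp [hu, hn _ _ (hen i)]
  rw [Finset.sum_eq_single i (fun j _ hj => by rw [hue j hj]; simp) (by simp), huei,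
    div_self (hgself i), hu, neg_one_smul, ← sub_eq_add_neg, add_sub_cancel_left, ← hy] at hv
  exact Quotient.sound ⟨_, hgself i, hv⟩

/-- Finitely many points of the projective space have representatives supported below a common
bound. -/
theorem exists_bound_support {ι : Type*} [Finite ι] (x : ι → ProjPoint ℚ) :
    ∃ n, ∀ i m, n ≤ m → (x i : ℕ → ℚ) m = 0 := by
  obtain ⟨n, hn⟩ := (Set.finite_iUnion fun i => (x i).2.1).bddAbove
  refine ⟨n + 1, fun i m hm => ?_⟩
  by_contra h
  have := hn (Set.mem_iUnion.2 ⟨i, h⟩)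
  omega

/-- finite homogeneity of ℚP^∞. -/
theorem finite_homogeneity_QPinf (A B : Set QPinf) (hA : A.Finite) (hB : B.Finite)
    (f : ↥A → ↥B) (hf : Function.Bijective f) :
    ∃ h : QPinf ≃ₜ QPinf, ∀ a : ↥A, h a = (f a : QPinf) := by
  have := hA.to_subtype
  obtain ⟨e, he⟩ := exists_injective_nat A
  let x : A → ProjPoint ℚ := fun a => a.1.out
  let y : A → ProjPoint ℚ := fun a => (f a).1.out
  have hx : ∀ a, Quotient.mk _ (x a) = a.1 := fun a => Quotient.out_eq _
  have hy : ∀ a, Quotient.mk _ (y a) = (f a).1 := fun a => Quotient.out_eq _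
  obtain ⟨n, hn⟩ := exists_bound_support x
  obtain ⟨k, hk⟩ := exists_bound_support y
  have he' : Function.Injective fun a => n + k + e a := fun a b h => he (Nat.add_left_cancel h)
  obtain ⟨h₁, hh₁⟩ := exists_homeomorph_to_coordinate_points x
    (fun a b h => Subtype.ext (by simpa only [hx] using h)) (n + k)
    (fun i m hm => hn i m (by omega)) _ he' (fun i => Nat.le_add_right _ _)
  obtain ⟨h₂, hh₂⟩ := exists_homeomorph_to_coordinate_points y
    (fun a b h => hf.1 (Subtype.ext (by simpa only [hy] using h))) (n + k)
    (fun i m hm => hk i m (by omega)) _ he' (fun i => Nat.le_add_right _ _)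
  refine ⟨h₁.trans h₂.symm, fun a => ?_⟩
  let p : ProjPoint ℚ := ⟨Pi.single (n + k + e a) 1,
    (Set.finite_singleton (n + k + e a)).subset fun m hm => by
      by_contra h
      exact hm (Pi.single_eq_of_ne h _), by simp⟩
  rw [Homeomorph.trans_apply, Homeomorph.symm_apply_eq, ← hx a, ← hy a, hh₁ a p rfl, hh₂ a p rfl]
end

section
/- Let G be a group acting by homeomorphisms on a topological space X such that every orbit Gx is closed in X, and suppose X possesses a vanishing sequence (Xn) of nonempty G-invariant closed subsets such that: (1) for any n ∈ ℕ and any nonempty G-invariant relatively open set U ⊆ Xn, the closure cl(U) in X contains some set Xm; and (2) for any n ∈ ℕ, any point x ∈ X \ Xn, and any open G-invariant neighborhood U ⊆ X of x, there exists an open G-invariant neighborhood V ⊆ X of x such that cl(V) ⊆ U ∪ Xn. Then the orbit space X/G (with the quotient topology) has a superskeleton. If moreover X is first-countable and X/G is countable, then X/G is homeomorphic to the infinite rational projective space ℚP^∞. -/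
open Set Topology TopologicalSpace

/-- A set is invariant under an action of `G`. -/
def MInvariant (G : Type*) {X : Type*} [SMul G X] (A : Set X) : Prop :=
  ∀ (g : G), ∀ x ∈ A, g • x ∈ A

/-- A topological space cut into strata `{x | r x = n}` by a rank function `r`, such that the sets
`{x | n ≤ r x}` are closed, their complements are zero-dimensional, every stratum accumulates at
all points of larger rank, and the closure of each nonempty relatively open piece of a stratum
contains all points of sufficiently large rank. -/
structure Stratified {X : Type*} [TopologicalSpace X] (r : X → ℕ) : Prop where
  t1 : T1Space X
  isClosed_le : ∀ n, IsClosed {x | n ≤ r x}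
  exists_le : ∀ n, ∃ x, n ≤ r x
  exists_clopen : ∀ n x U, IsOpen U → x ∈ U → r x < n →
    ∃ E, IsOpen E ∧ x ∈ E ∧ E ⊆ U ∧ E ⊆ {x | r x < n} ∧ closure E ⊆ E ∪ {x | n ≤ r x}
  dense_stratum : ∀ n, {x | n ≤ r x} ⊆ closure {x | r x = n}
  closure_piece : ∀ n V, IsOpen V → (∃ x ∈ V, r x = n) →
    ∃ m, {x | m ≤ r x} ⊆ closure (V ∩ {x | r x = n})

/-- `E` is a clopen subset of the open set of points of rank less than `n`. -/
structure ClopenBelow {X : Type*} [TopologicalSpace X] (r : X → ℕ) (n : ℕ) (E : Set X) :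
    Prop where
  isOpen : IsOpen E
  subset : E ⊆ {x | r x < n}
  closure_subset : closure E ⊆ E ∪ {x | n ≤ r x}

/-- `T` is a relatively open subset of the stratum of points of rank `n`. -/
def RelOpenInStratum {X : Type*} [TopologicalSpace X] (r : X → ℕ) (n : ℕ) (T : Set X) : Prop :=
  ∃ V, IsOpen V ∧ T = V ∩ {x | r x = n}

/-- The Rasiowa–Sikorski lemma in sequential form. -/
theorem exists_monotone_seq_meets {P ι : Type*} [Preorder P] [Countable ι] (p : P)
    (D : ι → Set P) (hD : ∀ i s, ∃ d ∈ D i, s ≤ d) :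
    ∃ f : ℕ → P, Monotone f ∧ ∀ i, ∃ n, f n ∈ D i := by
  have := Encodable.ofCountable ι
  let 𝒟 : ι → Order.Cofinal P := fun i => ⟨D i, fun s => hD i s⟩
  exact ⟨Order.sequenceOfCofinals p 𝒟, Order.sequenceOfCofinals.monotone p 𝒟,
    fun i => ⟨_, Order.sequenceOfCofinals.encode_mem p 𝒟 i⟩⟩

theorem Set.Finite.exists_uniform_bound {ι : Type*} {S : Set ι} (hS : S.Finite)
    {P : ι → ℕ → Prop} (h : ∀ i ∈ S, ∃ n, P i n) (hmono : ∀ i m n, m ≤ n → P i m → P i n) :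
    ∃ n, ∀ i ∈ S, P i n := by
  choose! f hf using h
  obtain ⟨n, hn⟩ := (hS.image f).bddAbove
  exact ⟨n, fun i hi => hmono i _ _ (hn ⟨i, hi, rfl⟩) (hf i hi)⟩

namespace ClopenBelow

variable {X : Type*} [TopologicalSpace X] {r : X → ℕ} {n m : ℕ} {D E : Set X}

theorem empty : ClopenBelow r n (∅ : Set X) := ⟨isOpen_empty, by simp, by simp⟩

theorem union (hD : ClopenBelow r n D) (hE : ClopenBelow r n E) : ClopenBelow r n (D ∪ E) where
  isOpen := hD.isOpen.union hE.isOpen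
  subset := union_subset hD.subset hE.subset
  closure_subset := by
    rw [closure_union]
    rintro x (h | h)
    · exact (hD.closure_subset h).imp_left Or.inl
    · exact (hE.closure_subset h).imp_left Or.inr

theorem notMem_closure (hD : ClopenBelow r n D) {x : X} (hx : x ∉ D) (hr : r x < n) :
    x ∉ closure D := fun h => (hD.closure_subset h).elim hx fun h => absurd h (not_le.2 hr)

theorem of_le (hnm : n ≤ m) (hE : ClopenBelow r m E) (hs : E ⊆ {x | r x < n}) :
    ClopenBelow r n E where
  isOpen := hE.isOpen
  subset := hs
  closure_subset := hE.closure_subset.trans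
    (union_subset_union_right _ fun _ hx => le_trans hnm hx)

end ClopenBelow

theorem RelOpenInStratum.diff {X : Type*} [TopologicalSpace X] {r : X → ℕ} {n M : ℕ}
    {T D : Set X} (hT : RelOpenInStratum r n T) (hn : n < M) (hD : ClopenBelow r M D) :
    RelOpenInStratum r n (T \ D) := by
  obtain ⟨V, hV, rfl⟩ := hT
  refine ⟨V \ closure D, hV.sdiff isClosed_closure, ?_⟩
  ext x
  constructor
  · rintro ⟨⟨h1, h2⟩, h3⟩
    exact ⟨⟨h1, hD.notMem_closure h3 (by rw [show r x = n from h2]; exact hn)⟩, h2⟩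
  · rintro ⟨⟨h1, h2⟩, h3⟩
    exact ⟨⟨h1, h3⟩, fun h => h2 (subset_closure h)⟩

namespace Stratified

variable {X : Type*} [TopologicalSpace X] {r : X → ℕ}

theorem isOpen_lt (h : Stratified r) (n : ℕ) : IsOpen {x | r x < n} := by
  convert (h.isClosed_le n).isOpen_compl using 1
  ext; simp

theorem exists_clopenBelow (h : Stratified r) {n : ℕ} {x : X} {U : Set X} (hU : IsOpen U)
    (hx : x ∈ U) (hr : r x < n) : ∃ E, ClopenBelow r n E ∧ x ∈ E ∧ E ⊆ U := by
  obtain ⟨E, h1, h2, h3, h4, h5⟩ := h.exists_clopen n x U hU hx hr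
  exact ⟨E, ⟨h1, h4, h5⟩, h2, h3⟩

theorem exists_ne_of_subset_closure (h : Stratified r) {n : ℕ} {S : Set X}
    (hS : {x | n ≤ r x} ⊆ closure S) (z : X) : ∃ t ∈ S, t ≠ z := by
  have := h.t1
  by_contra! hcon
  obtain ⟨x, hx⟩ := h.exists_le (n + r z + 1)
  have hxz : x ∈ ({z} : Set X) :=
    closure_minimal (fun t ht => hcon t ht) isClosed_singleton (hS (show n ≤ r x by omega))
  rw [mem_singleton_iff.1 hxz] at hx
  omega

/-- A point can be surrounded by a small clopen set whose removal keeps the given finitely many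
sets accumulating at all points of rank at least `M`. -/
theorem exists_clopenBelow_of_subset_closure_diff (h : Stratified r) {M : ℕ} {𝒯 : Set (Set X)}
    (hfin : 𝒯.Finite) (hrel : ∀ T ∈ 𝒯, ∃ n < M, RelOpenInStratum r n T) {D : Set X}
    (hD : ClopenBelow r M D) (hacc : ∀ T ∈ 𝒯, {x | M ≤ r x} ⊆ closure (T \ D))
    {z : X} (hz : z ∉ D) (hr : r z < M) {V : Set X} (hV : IsOpen V) (hzV : z ∈ V) :
    ∃ E, ClopenBelow r M E ∧ z ∈ E ∧ E ⊆ V ∧ Disjoint D E ∧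
      ∀ T ∈ 𝒯, {x | M ≤ r x} ⊆ closure (T \ (D ∪ E)) := by
  have := h.t1
  have : Nonempty X := ⟨z⟩
  have hpt : ∀ T ∈ 𝒯, ∃ t, t ∈ T \ D ∧ t ≠ z := fun T hT =>
    h.exists_ne_of_subset_closure (hacc T hT) z
  choose! t ht htz using hpt
  obtain ⟨E₀, hE₀, hzE₀, hE₀V⟩ := h.exists_clopenBelow (n := M) (x := z)
    (U := (V \ closure D) \ t '' 𝒯)
    ((hV.sdiff isClosed_closure).sdiff (hfin.image t).isClosed)
    ⟨⟨hzV, hD.notMem_closure hz hr⟩, by rintro ⟨T, hT, hE⟩; exact htz T hT hE⟩ hr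
  obtain ⟨M', hM'⟩ := hfin.exists_uniform_bound
    (P := fun T m => {x | m ≤ r x} ⊆ closure (T \ (D ∪ E₀)))
    (by
      intro T hT
      obtain ⟨n, hn, hTn⟩ := hrel T hT
      have hmem : t T ∈ T \ (D ∪ E₀) :=
        ⟨(ht T hT).1, by
          rintro (h' | h')
          · exact (ht T hT).2 h'
          · exact (hE₀V h').2 ⟨T, hT, rfl⟩⟩
      obtain ⟨W, hW, hWe⟩ := hTn.diff hn (hD.union hE₀)
      rw [hWe] at hmem ⊢
      exact h.closure_piece n W hW ⟨_, hmem⟩)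
    (fun T m n hmn hm x hx => hm (le_trans hmn hx))
  obtain ⟨E, hE, hzE, hEE₀⟩ := h.exists_clopenBelow (n := max M M') hE₀.isOpen hzE₀
    (lt_of_lt_of_le hr (le_max_left _ _))
  refine ⟨E, hE.of_le (le_max_left _ _) (hEE₀.trans hE₀.subset), hzE,
    fun x hx => (hE₀V (hEE₀ hx)).1.1,
    disjoint_left.2 fun x hxD hxE => (hE₀V (hEE₀ hxE)).1.2 (subset_closure hxD), ?_⟩
  intro T hT y (hy : M ≤ r y)
  by_cases hyM : M' ≤ r y
  · exact closure_mono (sdiff_subset_sdiff_right (union_subset_union_right _ hEE₀))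
      (hM' T hT hyM)
  · have hyE : y ∉ closure E := hE.notMem_closure
      (fun hyE => not_lt.2 hy (show r y < M from hE₀.subset (hEE₀ hyE)))
      (lt_of_lt_of_le (not_le.1 hyM) (le_max_right _ _))
    refine mem_closure_iff.2 fun O hO hyO => ?_
    obtain ⟨w, ⟨hwO, hwE⟩, hwT, hwD⟩ := mem_closure_iff.1 (hacc T hT hy) (O \ closure E)
      (hO.sdiff isClosed_closure) ⟨hyO, hyE⟩
    exact ⟨w, hwO, hwT, by rintro (hw | hw); exacts [hwD hw, hwE (subset_closure hw)]⟩

/-- A point `p` of an open set `U` has a neighbourhood in `U`, clopen below `M`, such that the given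
finitely many subsets of `U` accumulate at all points of rank at least `M` both inside and
outside of it. -/
theorem exists_splitting (h : Stratified r) [Countable X] [SecondCountableTopology X] {M : ℕ}
    {𝒯 : Set (Set X)} (hfin : 𝒯.Finite) (hrel : ∀ T ∈ 𝒯, ∃ n < M, RelOpenInStratum r n T)
    (hacc : ∀ T ∈ 𝒯, {x | M ≤ r x} ⊆ closure T) {U : Set X} (hU : IsOpen U)
    (hTU : ∀ T ∈ 𝒯, T ⊆ U) {p : X} (hp : p ∈ U) (hpM : r p < M) :
    ∃ N, ClopenBelow r M N ∧ p ∈ N ∧ N ⊆ U ∧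
      ∀ T ∈ 𝒯, {x | M ≤ r x} ⊆ closure (T ∩ N) ∧ {x | M ≤ r x} ⊆ closure (T \ N) := by
  let P := {s : Set X × Set X // ClopenBelow r M s.1 ∧ ClopenBelow r M s.2 ∧ Disjoint s.1 s.2 ∧
    s.1 ⊆ U ∧ p ∈ s.1 ∧ ∀ T ∈ 𝒯, {x | M ≤ r x} ⊆ closure (T \ (s.1 ∪ s.2))}
  have addLeft : ∀ (s : P) z, z ∉ s.1.1 ∪ s.1.2 → r z < M → z ∈ U →
      ∃ s' : P, s ≤ s' ∧ z ∈ s'.1.1 := by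
    rintro ⟨⟨A, B⟩, hA, hB, hAB, hAU, hpA, hT⟩ z hz hr hzU
    obtain ⟨E, hE, hzE, hEU, hDE, hET⟩ :=
      h.exists_clopenBelow_of_subset_closure_diff hfin hrel (hA.union hB) hT hz hr hU hzU
    rw [disjoint_union_left] at hDE
    refine ⟨⟨⟨A ∪ E, B⟩, hA.union hE, hB, disjoint_union_left.2 ⟨hAB, hDE.2.symm⟩,
      union_subset hAU hEU, Or.inl hpA, ?_⟩, ⟨subset_union_left, subset_rfl⟩, Or.inr hzE⟩
    intro T hT
    have := hET T hT
    rwa [union_right_comm] at this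
  have addRight : ∀ (s : P) z, z ∉ s.1.1 ∪ s.1.2 → r z < M →
      ∃ s' : P, s ≤ s' ∧ z ∈ s'.1.2 := by
    rintro ⟨⟨A, B⟩, hA, hB, hAB, hAU, hpA, hT⟩ z hz hr
    obtain ⟨E, hE, hzE, -, hDE, hET⟩ :=
      h.exists_clopenBelow_of_subset_closure_diff hfin hrel (hA.union hB) hT hz hr isOpen_univ
        (mem_univ z)
    rw [disjoint_union_left] at hDE
    refine ⟨⟨⟨A, B ∪ E⟩, hA, hB.union hE, disjoint_union_right.2 ⟨hAB, hDE.1⟩,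
      hAU, hpA, ?_⟩, ⟨subset_rfl, subset_union_left⟩, Or.inr hzE⟩
    intro T hT
    have := hET T hT
    rwa [union_assoc] at this
  have pick : ∀ (s : P) (V : Set X), IsOpen V → (V ∩ {x | M ≤ r x}).Nonempty → ∀ T ∈ 𝒯,
      ∃ z ∈ V ∩ T, z ∉ s.1.1 ∪ s.1.2 ∧ r z < M := by
    rintro s V hV ⟨y, hyV, hy⟩ T hT
    obtain ⟨z, hzV, hzT, hz⟩ := mem_closure_iff.1 (s.2.2.2.2.2.2 T hT hy) V hV hyV
    obtain ⟨n, hn, W, -, rfl⟩ := hrel T hT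
    exact ⟨z, ⟨hzV, hzT⟩, hz, lt_of_eq_of_lt hzT.2 hn⟩
  obtain ⟨E, hE, hpE, hEU, -, hET⟩ :=
    h.exists_clopenBelow_of_subset_closure_diff (D := ∅) hfin hrel ClopenBelow.empty
      (by simpa using hacc) (notMem_empty p) hpM hU hp
  let s₀ : P := ⟨⟨E, ∅⟩, hE, ClopenBelow.empty, disjoint_empty _, hEU, hpE, by simpa using hET⟩
  have := (countable_countableBasis X).to_subtype
  have := hfin.countable.to_subtype
  obtain ⟨f, hf, hfD⟩ := exists_monotone_seq_meets (ι := X ⊕ (countableBasis X × 𝒯)) s₀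
    (Sum.elim (fun z => {s | r z < M → z ∈ s.1.1 ∪ s.1.2})
      (fun q => {s | (q.1.1 ∩ {x | M ≤ r x}).Nonempty →
        (q.1.1 ∩ (q.2.1 ∩ s.1.1)).Nonempty ∧ (q.1.1 ∩ (q.2.1 ∩ s.1.2)).Nonempty}))
    (by
      rintro (z | ⟨⟨V, hV⟩, T, hT⟩) s
      · by_cases hz : z ∈ s.1.1 ∪ s.1.2
        · exact ⟨s, fun _ => hz, le_rfl⟩
        by_cases hr : r z < M
        · obtain ⟨s', hs, hz'⟩ := addRight s z hz hr
          exact ⟨s', fun _ => Or.inr hz', hs⟩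
        · exact ⟨s, fun h => absurd h hr, le_rfl⟩
      · by_cases hne : (V ∩ {x | M ≤ r x}).Nonempty
        · have hVo := isOpen_of_mem_countableBasis hV
          obtain ⟨z, hz, hzs, hzr⟩ := pick s V hVo hne T hT
          obtain ⟨s', hs', hz'⟩ := addLeft s z hzs hzr (hTU T hT hz.2)
          obtain ⟨w, hw, hws, hwr⟩ := pick s' V hVo hne T hT
          obtain ⟨s'', hs'', hw'⟩ := addRight s' w hws hwr
          exact ⟨s'', fun _ => ⟨⟨z, hz.1, hz.2, hs''.1 hz'⟩, ⟨w, hw.1, hw.2, hw'⟩⟩,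
            hs'.trans hs''⟩
        · exact ⟨s, fun h => absurd h hne, le_rfl⟩)
  have hdisj : ∀ i j, Disjoint (f i).1.1 (f j).1.2 := fun i j =>
    (f (max i j)).2.2.2.1.mono (hf (le_max_left i j)).1 (hf (le_max_right i j)).2
  have hcover : ∀ z, r z < M → ∃ n, z ∈ (f n).1.1 ∪ (f n).1.2 := fun z hz => by
    obtain ⟨n, hn⟩ := hfD (Sum.inl z)
    exact ⟨n, hn hz⟩
  have hmeet : ∀ T ∈ 𝒯, ∀ y, M ≤ r y → ∀ V, IsOpen V → y ∈ V → ∃ n,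
      (V ∩ (T ∩ (f n).1.1)).Nonempty ∧ (V ∩ (T ∩ (f n).1.2)).Nonempty := by
    intro T hT y hy V hV hyV
    obtain ⟨W, hW, hyW, hWV⟩ :=
      (isBasis_countableBasis X).exists_subset_of_mem_open hyV hV
    obtain ⟨n, hn⟩ := hfD (Sum.inr ⟨⟨W, hW⟩, ⟨T, hT⟩⟩)
    obtain ⟨h1, h2⟩ := hn ⟨y, hyW, hy⟩
    exact ⟨n, h1.mono (inter_subset_inter_left _ hWV), h2.mono (inter_subset_inter_left _ hWV)⟩
  refine ⟨⋃ n, (f n).1.1, ⟨isOpen_iUnion fun n => (f n).2.1.isOpen,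
    iUnion_subset fun n => (f n).2.1.subset, ?_⟩, mem_iUnion.2 ⟨0, (f 0).2.2.2.2.2.1⟩,
    iUnion_subset fun n => (f n).2.2.2.2.1, fun T hT => ⟨fun y hy => ?_, fun y hy => ?_⟩⟩
  · intro x hx
    by_contra hcon
    rw [mem_union, not_or] at hcon
    obtain ⟨n, hn | hn⟩ := hcover x (not_le.1 hcon.2)
    · exact hcon.1 (mem_iUnion.2 ⟨n, hn⟩)
    · obtain ⟨w, hw, hwA⟩ := mem_closure_iff.1 hx _ (f n).2.2.1.isOpen hn
      obtain ⟨i, hi⟩ := mem_iUnion.1 hwA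
      exact disjoint_left.1 (hdisj i n) hi hw
  · rw [mem_closure_iff]
    intro V hV hyV
    obtain ⟨n, ⟨w, hw, hwT, hwA⟩, -⟩ := hmeet T hT y hy V hV hyV
    exact ⟨w, hw, hwT, mem_iUnion.2 ⟨n, hwA⟩⟩
  · rw [mem_closure_iff]
    intro V hV hyV
    obtain ⟨n, -, w, hw, hwT, hwB⟩ := hmeet T hT y hy V hV hyV
    refine ⟨w, hw, hwT, fun hwA => ?_⟩
    obtain ⟨i, hi⟩ := mem_iUnion.1 hwA
    exact disjoint_left.1 (hdisj i n) hi hwB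

end Stratified

/-- `x` and `y` have the same rank and lie in the corresponding members of two families. -/
def SameType {X Y ι : Type*} (r : X → ℕ) (r' : Y → ℕ) (Q : Set ι) (N : ι → Set X)
    (L : ι → Set Y) (x : X) (y : Y) : Prop :=
  r x = r' y ∧ ∀ q ∈ Q, x ∈ N q ↔ y ∈ L q

/-- `x` has rank at most that of `y`, and the members of the family that are clopen around `y` do
not separate `x` from `y`. -/
def TypeBelow {X ι : Type*} (r : X → ℕ) (Q : Set ι) (N : ι → Set X) (m : ι → ℕ) (x y : X) : Prop :=
  r x ≤ r y ∧ ∀ q ∈ Q, r y < m q → (x ∈ N q ↔ y ∈ N q)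

/-- A family of sets `N q`, clopen below `m q`, such that every point is a limit of points
of each type that is not separated from it by the family. -/
structure TypeSystem {X ι : Type*} [TopologicalSpace X] (r : X → ℕ) (Q : Set ι) (N : ι → Set X)
    (m : ι → ℕ) : Prop where
  clopenBelow : ∀ q ∈ Q, ClopenBelow r (m q) (N q)
  accumulates : ∀ x y, TypeBelow r Q N m x y → ∀ U, IsOpen U → y ∈ U →
    ∃ z ∈ U, z ≠ y ∧ SameType r r Q N N z x

namespace SameType

variable {X Y Z ι : Type*} {r : X → ℕ} {r' : Y → ℕ} {r'' : Z → ℕ} {Q : Set ι} {N : ι → Set X}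
  {N' : ι → Set Y} {N'' : ι → Set Z} {x : X} {y : Y} {z : Z}

theorem symm (h : SameType r r' Q N N' x y) : SameType r' r Q N' N y x :=
  ⟨h.1.symm, fun q hq => (h.2 q hq).symm⟩

theorem trans (h : SameType r r' Q N N' x y) (h' : SameType r' r'' Q N' N'' y z) :
    SameType r r'' Q N N'' x z :=
  ⟨h.1.trans h'.1, fun q hq => (h.2 q hq).trans (h'.2 q hq)⟩

theorem insert_iff {q : ι} :
    SameType r r' (insert q Q) N N' x y ↔
      SameType r r' Q N N' x y ∧ (x ∈ N q ↔ y ∈ N' q) := by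
  simp only [SameType, forall_mem_insert]
  tauto

theorem typeBelow_iff {m : ι → ℕ} {x₁ x₂ : X} {y₁ y₂ : Y} (h₁ : SameType r r' Q N N' x₁ y₁)
    (h₂ : SameType r r' Q N N' x₂ y₂) : TypeBelow r Q N m x₁ x₂ ↔ TypeBelow r' Q N' m y₁ y₂ := by
  unfold TypeBelow
  rw [h₁.1, h₂.1]
  refine and_congr_right fun _ => forall₂_congr fun q hq => ?_
  rw [h₁.2 q hq, h₂.2 q hq]

theorem finite_types (r : X → ℕ) (N : ι → Set X) (hQ : Q.Finite) (k : ℕ) (U : Set X)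
    {S : Set X} (hS : ∀ x ∈ S, r x ≤ k) :
    ((fun x => U ∩ {z | SameType r r Q N N z x}) '' S).Finite := by
  refine (((finite_Iic k).prod hQ.finite_subsets).image
    (fun a : ℕ × Set ι => U ∩ {z | r z = a.1 ∧ ∀ q ∈ Q, z ∈ N q ↔ q ∈ a.2})).subset ?_
  rintro _ ⟨x, hx, rfl⟩
  refine ⟨⟨r x, {q ∈ Q | x ∈ N q}⟩, ⟨hS x hx, fun q hq => hq.1⟩, ?_⟩
  ext z
  refine and_congr_right fun _ => and_congr_right fun _ => forall₂_congr fun q hq => ?_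
  simp [hq]

end SameType

theorem Stratified.typeSystem_empty {X ι : Type*} [TopologicalSpace X] {r : X → ℕ}
    (h : Stratified r) (N : ι → Set X) (m : ι → ℕ) : TypeSystem r ∅ N m where
  clopenBelow := by simp
  accumulates := by
    have := h.t1
    rintro x y ⟨hxy, -⟩ U hU hy
    simp only [SameType, mem_empty_iff_false, false_imp_iff, implies_true, and_true]
    rcases hxy.lt_or_eq with hlt | heq
    · obtain ⟨z, hzU, hz⟩ := mem_closure_iff.1 (h.dense_stratum (r x) hxy) U hU hy
      exact ⟨z, hzU, by rintro rfl; exact hlt.ne (Eq.symm hz), hz⟩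
    · obtain ⟨k, hk⟩ := h.closure_piece (r x) U hU ⟨y, hy, heq.symm⟩
      obtain ⟨z, ⟨hzU, hz⟩, hzy⟩ := h.exists_ne_of_subset_closure hk y
      exact ⟨z, hzU, hzy, hz⟩

namespace TypeSystem

variable {X ι : Type*} [TopologicalSpace X] {r : X → ℕ} {Q : Set ι} {N : ι → Set X} {m : ι → ℕ}

theorem lt_of_mem (hs : TypeSystem r Q N m) {q : ι} (hq : q ∈ Q) {x : X} (hx : x ∈ N q) :
    r x < m q := (hs.clopenBelow q hq).subset hx

/-- The points not separated from `p` by the sets of the family that are clopen around `p`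
contain a neighbourhood of `p`. -/
theorem exists_isOpen_typeBelow (hs : TypeSystem r Q N m) (h : Stratified r) (hQ : Q.Finite)
    (p : X) : ∃ U, IsOpen U ∧ p ∈ U ∧ ∀ x ∈ U, TypeBelow r Q N m x p := by
  classical
  refine ⟨{x | r x < r p + 1} ∩
    ⋂ q ∈ Q, if r p < m q then (if p ∈ N q then N q else (closure (N q))ᶜ) else univ,
    (h.isOpen_lt _).inter (hQ.isOpen_biInter fun q hq => ?_), ⟨Nat.lt_succ_self _, ?_⟩, ?_⟩
  · split_ifs
    exacts [(hs.clopenBelow q hq).isOpen, isClosed_closure.isOpen_compl, isOpen_univ]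
  · simp only [mem_iInter]
    intro q hq
    split_ifs with h1 h2
    exacts [h2, (hs.clopenBelow q hq).notMem_closure h2 h1, mem_univ _]
  · rintro x ⟨hx, hxQ⟩
    refine ⟨Nat.lt_succ_iff.1 hx, fun q hq hlt => ?_⟩
    simp only [mem_iInter] at hxQ
    have := hxQ q hq
    rw [if_pos hlt] at this
    split_ifs at this with h2
    · exact iff_of_true this h2
    · exact iff_of_false (fun h => this (subset_closure h)) h2

theorem relOpen_sameType (hs : TypeSystem r Q N m) (h : Stratified r) (hQ : Q.Finite) (x : X) :
    RelOpenInStratum r (r x) {z | SameType r r Q N N z x} := by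
  obtain ⟨U, hU, hxU, hUx⟩ := hs.exists_isOpen_typeBelow h hQ x
  classical
  refine ⟨⋂ q ∈ Q, if r x < m q then (if x ∈ N q then N q else (closure (N q))ᶜ) else univ,
    hQ.isOpen_biInter fun q hq => ?_, ?_⟩
  · split_ifs
    exacts [(hs.clopenBelow q hq).isOpen, isClosed_closure.isOpen_compl, isOpen_univ]
  · ext z
    simp only [mem_ite_univ_right, mem_ofPred_eq, mem_inter_iff, mem_iInter, SameType]
    rw [and_comm]
    refine and_congr_left fun hr => forall₂_congr fun q hq => ?_
    have hq' := hs.clopenBelow q hq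
    constructor
    · intro hz hlt
      split_ifs with h2
      · exact hz.2 h2
      · exact hq'.notMem_closure (fun h => h2 (hz.1 h)) (hr.trans_lt hlt)
    · intro hz
      by_cases hlt : r x < m q
      · have := hz hlt
        split_ifs at this with h2
        · exact iff_of_true this h2
        · exact iff_of_false (fun h => this (subset_closure h)) h2
      · exact iff_of_false (fun hz => hlt (hr ▸ hs.lt_of_mem hq hz))
          (fun hx => hlt (hs.lt_of_mem hq hx))

/-- A type system can be extended by a small neighbourhood of a given point `p`, clopen below any
sufficiently large `M`, that realizes precisely the types below `p`. -/
theorem exists_extension (hs : TypeSystem r Q N m) (h : Stratified r) [Countable X]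
    [SecondCountableTopology X] (hQ : Q.Finite) {p : X} {U : Set X} (hU : IsOpen U) (hp : p ∈ U) :
    ∃ m₀, ∀ M, m₀ ≤ M → ∃ N₀, ClopenBelow r M N₀ ∧ p ∈ N₀ ∧ N₀ ⊆ U ∧
      (∀ x ∈ N₀, TypeBelow r Q N m x p) ∧
      (∀ x, TypeBelow r Q N m x p → ∃ z ∈ N₀, SameType r r Q N N z x) ∧
      (∀ x, ∃ z ∉ N₀, SameType r r Q N N z x) ∧
      (∀ x y, TypeBelow r Q N m x y → (r y < M → (x ∈ N₀ ↔ y ∈ N₀)) → ∀ V, IsOpen V → y ∈ V →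
        ∃ z ∈ V, z ≠ y ∧ SameType r r Q N N z x ∧ (z ∈ N₀ ↔ x ∈ N₀)) := by
  obtain ⟨W, hW, hpW, hWp⟩ := hs.exists_isOpen_typeBelow h hQ p
  set 𝒯 : Set (Set X) :=
    (fun x => (U ∩ W) ∩ {z | SameType r r Q N N z x}) '' {x | TypeBelow r Q N m x p}
  have hfin : 𝒯.Finite := SameType.finite_types r N hQ (r p) _ fun x hx => hx.1
  have hUW := hU.inter hW
  have hrel : ∀ T ∈ 𝒯, ∃ n ≤ r p, RelOpenInStratum r n T ∧ T.Nonempty := by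
    rintro _ ⟨x, hx, rfl⟩
    obtain ⟨V, hV, hVe⟩ := hs.relOpen_sameType h hQ x
    refine ⟨r x, hx.1, ⟨(U ∩ W) ∩ V, hUW.inter hV, ?_⟩, ?_⟩
    · simp only [hVe, inter_assoc]
    · obtain ⟨z, hz, -, hzx⟩ := hs.accumulates x p hx _ hUW ⟨hp, hpW⟩
      exact ⟨z, hz, hzx⟩
  obtain ⟨m₁, hm₁⟩ := hfin.exists_uniform_bound (P := fun T k => {x | k ≤ r x} ⊆ closure T)
    (by
      intro T hT
      obtain ⟨n, -, ⟨V, hV, rfl⟩, hne⟩ := hrel T hT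
      exact h.closure_piece n V hV hne)
    (fun T k n hkn hk x hx => hk (le_trans hkn hx))
  obtain ⟨m₂, hm₂⟩ := hQ.exists_uniform_bound (P := fun q k => m q ≤ k)
    (fun q _ => ⟨m q, le_rfl⟩) (fun _ _ _ h1 h2 => h2.trans h1)
  refine ⟨max (max m₁ m₂) (r p + 1), fun M hM => ?_⟩
  simp only [max_le_iff] at hM
  obtain ⟨N₀, hN₀, hpN, hNU, hNT⟩ := h.exists_splitting (M := M) hfin
    (fun T hT => by
      obtain ⟨n, hn, hT', -⟩ := hrel T hT
      exact ⟨n, by omega, hT'⟩)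
    (fun T hT x hx => hm₁ T hT (hM.1.1.trans hx)) hUW
    (by rintro _ ⟨x, -, rfl⟩; exact inter_subset_left) ⟨hp, hpW⟩ (by omega)
  have hbelow : ∀ x ∈ N₀, TypeBelow r Q N m x p := fun x hx => hWp x (hNU hx).2
  obtain ⟨y₀, hy₀⟩ := h.exists_le M
  refine ⟨N₀, hN₀, hpN, fun x hx => (hNU hx).1, hbelow, ?_, ?_, ?_⟩
  · intro x hx
    obtain ⟨z, -, hz, hzN⟩ :=
      mem_closure_iff.1 ((hNT _ ⟨x, hx, rfl⟩).1 hy₀) univ isOpen_univ (mem_univ _)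
    exact ⟨z, hzN, hz.2⟩
  · intro x
    by_cases hx : TypeBelow r Q N m x p
    · obtain ⟨z, -, hz, hzN⟩ :=
        mem_closure_iff.1 ((hNT _ ⟨x, hx, rfl⟩).2 hy₀) univ isOpen_univ (mem_univ _)
      exact ⟨z, hzN, hz.2⟩
    · exact ⟨x, fun hxN => hx (hbelow x hxN), rfl, fun _ _ => Iff.rfl⟩
  · intro x y hxy hMxy V hV hyV
    by_cases hyM : r y < M
    · have hiff := hMxy hyM
      by_cases hyN : y ∈ N₀
      · obtain ⟨z, hz, hzy, hzx⟩ := hs.accumulates x y hxy _ (hV.inter hN₀.isOpen) ⟨hyV, hyN⟩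
        exact ⟨z, hz.1, hzy, hzx, iff_of_true hz.2 (hiff.2 hyN)⟩
      · obtain ⟨z, hz, hzy, hzx⟩ := hs.accumulates x y hxy _ (hV.sdiff isClosed_closure)
          ⟨hyV, hN₀.notMem_closure hyN hyM⟩
        exact ⟨z, hz.1, hzy, hzx,
          iff_of_false (fun hzN => hz.2 (subset_closure hzN)) (fun hxN => hyN (hiff.1 hxN))⟩
    · rw [not_lt] at hyM
      by_cases hx : TypeBelow r Q N m x p
      · have hne : ∀ z, SameType r r Q N N z x → z ≠ y := by
          rintro z hz rfl
          have := hz.1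
          have := hx.1
          omega
        by_cases hxN : x ∈ N₀
        · obtain ⟨z, hzV, hz, hzN⟩ :=
            mem_closure_iff.1 ((hNT _ ⟨x, hx, rfl⟩).1 hyM) V hV hyV
          exact ⟨z, hzV, hne z hz.2, hz.2, iff_of_true hzN hxN⟩
        · obtain ⟨z, hzV, hz, hzN⟩ :=
            mem_closure_iff.1 ((hNT _ ⟨x, hx, rfl⟩).2 hyM) V hV hyV
          exact ⟨z, hzV, hne z hz.2, hz.2, iff_of_false hzN hxN⟩
      · obtain ⟨z, hzV, hzy, hzx⟩ := hs.accumulates x y hxy V hV hyV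
        have hself : SameType r r Q N N p p := ⟨rfl, fun _ _ => Iff.rfl⟩
        exact ⟨z, hzV, hzy, hzx, iff_of_false
          (fun hzN => hx ((hzx.typeBelow_iff hself).1 (hbelow z hzN)))
          (fun hxN => hx (hbelow x hxN))⟩

/-- The extension of a type system by one more set. -/
theorem insert (hs : TypeSystem r Q N m) {q : ι} (hq : ClopenBelow r (m q) (N q))
    (hacc : ∀ x y, TypeBelow r Q N m x y → (r y < m q → (x ∈ N q ↔ y ∈ N q)) →
      ∀ V, IsOpen V → y ∈ V → ∃ z ∈ V, z ≠ y ∧ SameType r r Q N N z x ∧ (z ∈ N q ↔ x ∈ N q)) :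
    TypeSystem r (insert q Q) N m where
  clopenBelow := forall_mem_insert.2 ⟨hq, hs.clopenBelow⟩
  accumulates x y hxy U hU hy := by
    simp only [TypeBelow, forall_mem_insert] at hxy
    simpa only [SameType.insert_iff] using hacc x y ⟨hxy.1, hxy.2.2⟩ hxy.2.1 U hU hy

end TypeSystem

section BackAndForth

variable {X Y : Type*} [TopologicalSpace X] [TopologicalSpace Y] {r : X → ℕ} {r' : Y → ℕ}

/-- A finite approximation to a homeomorphism between stratified spaces: finitely many pairs
of corresponding sets, each with a level, and finitely many pairs of corresponding points. -/
structure IsApprox (r : X → ℕ) (r' : Y → ℕ) (Q : Set (Set X × Set Y × ℕ)) (F : Set (X × Y)) :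
    Prop where
  finite_sets : Q.Finite
  finite_points : F.Finite
  left : TypeSystem r Q (fun q => q.1) (fun q => q.2.2)
  right : TypeSystem r' Q (fun q => q.2.1) (fun q => q.2.2)
  exists_right : ∀ x, ∃ y, SameType r r' Q (fun q => q.1) (fun q => q.2.1) x y
  exists_left : ∀ y, ∃ x, SameType r r' Q (fun q => q.1) (fun q => q.2.1) x y
  sameType : ∀ p ∈ F, SameType r r' Q (fun q => q.1) (fun q => q.2.1) p.1 p.2
  fst_eq_iff : ∀ p ∈ F, ∀ p' ∈ F, p.1 = p'.1 ↔ p.2 = p'.2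

namespace IsApprox

variable {Q : Set (Set X × Set Y × ℕ)} {F : Set (X × Y)}

theorem insert_point (ha : IsApprox r r' Q F) {x : X} {y : Y}
    (hxy : SameType r r' Q (fun q => q.1) (fun q => q.2.1) x y) (hx : x ∉ Prod.fst '' F)
    (hy : y ∉ Prod.snd '' F) : IsApprox r r' Q (insert (x, y) F) where
  finite_sets := ha.finite_sets
  finite_points := ha.finite_points.insert _
  left := ha.left
  right := ha.right
  exists_right := ha.exists_right
  exists_left := ha.exists_left
  sameType := forall_mem_insert.2 ⟨hxy, ha.sameType⟩
  fst_eq_iff := by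
    have hx' : ∀ p ∈ F, p.1 ≠ x := fun p hp h => hx ⟨p, hp, h⟩
    have hy' : ∀ p ∈ F, p.2 ≠ y := fun p hp h => hy ⟨p, hp, h⟩
    refine forall_mem_insert.2 ⟨forall_mem_insert.2 ⟨by simp, fun p hp => ?_⟩,
      fun p hp => forall_mem_insert.2 ⟨?_, ha.fst_eq_iff p hp⟩⟩
    · exact iff_of_false (hx' p hp).symm (hy' p hp).symm
    · exact iff_of_false (hx' p hp) (hy' p hp)

theorem exists_mem_fst (ha : IsApprox r r' Q F) (h' : Stratified r') (x : X) :
    ∃ F', F ⊆ F' ∧ IsApprox r r' Q F' ∧ x ∈ Prod.fst '' F' := by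
  have := h'.t1
  by_cases hx : x ∈ Prod.fst '' F
  · exact ⟨F, subset_rfl, ha, hx⟩
  obtain ⟨y, hxy⟩ := ha.exists_right x
  obtain ⟨z, hz, hzy, hzs⟩ := ha.right.accumulates y y ⟨le_rfl, fun _ _ _ => Iff.rfl⟩
    (Prod.snd '' F \ {y})ᶜ ((ha.finite_points.image _).sdiff).isClosed.isOpen_compl (by simp)
  refine ⟨_, subset_insert _ _, ha.insert_point (hxy.trans hzs.symm) hx
    (fun h => hz ⟨h, hzy⟩), _, mem_insert _ _, rfl⟩

theorem exists_mem_snd (ha : IsApprox r r' Q F) (h : Stratified r) (y : Y) :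
    ∃ F', F ⊆ F' ∧ IsApprox r r' Q F' ∧ y ∈ Prod.snd '' F' := by
  have := h.t1
  by_cases hy : y ∈ Prod.snd '' F
  · exact ⟨F, subset_rfl, ha, hy⟩
  obtain ⟨x, hxy⟩ := ha.exists_left y
  obtain ⟨z, hz, hzx, hzs⟩ := ha.left.accumulates x x ⟨le_rfl, fun _ _ _ => Iff.rfl⟩
    (Prod.fst '' F \ {x})ᶜ ((ha.finite_points.image _).sdiff).isClosed.isOpen_compl (by simp)
  refine ⟨_, subset_insert _ _, ha.insert_point (hzs.trans hxy)
    (fun h => hz ⟨h, hzx⟩) hy, _, mem_insert _ _, rfl⟩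

variable [Countable X] [SecondCountableTopology X] [Countable Y] [SecondCountableTopology Y]

theorem exists_insert_set (ha : IsApprox r r' Q F) (h : Stratified r) (h' : Stratified r')
    {p : X × Y} (hp : p ∈ F) {U : Set X} {V : Set Y} (hU : IsOpen U) (hpU : p.1 ∈ U)
    (hV : IsOpen V) (hpV : p.2 ∈ V) :
    ∃ q : Set X × Set Y × ℕ, p.1 ∈ q.1 ∧ q.1 ⊆ U ∧ q.2.1 ⊆ V ∧ IsApprox r r' (insert q Q) F := by
  have := h.t1
  have := h'.t1
  obtain ⟨m₁, hm₁⟩ := ha.left.exists_extension h ha.finite_sets (p := p.1)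
    (U := U \ (Prod.fst '' F \ {p.1}))
    (hU.sdiff ((ha.finite_points.image _).sdiff).isClosed) ⟨hpU, by simp⟩
  obtain ⟨m₂, hm₂⟩ := ha.right.exists_extension h' ha.finite_sets (p := p.2)
    (U := V \ (Prod.snd '' F \ {p.2}))
    (hV.sdiff ((ha.finite_points.image _).sdiff).isClosed) ⟨hpV, by simp⟩
  obtain ⟨A, hA, hpA, hAU, hAb, hAt, hAo, hAacc⟩ := hm₁ (max m₁ m₂) (le_max_left _ _)
  obtain ⟨B, hB, hpB, hBV, hBb, hBt, hBo, hBacc⟩ := hm₂ (max m₁ m₂) (le_max_right _ _)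
  have hpp := ha.sameType p hp
  refine ⟨(A, B, max m₁ m₂), hpA, hAU.trans sdiff_subset, hBV.trans sdiff_subset,
    ⟨ha.finite_sets.insert _, ha.finite_points, ha.left.insert hA hAacc,
      ha.right.insert hB hBacc, fun x => ?_, fun y => ?_, fun p' hp' => ?_, ha.fst_eq_iff⟩⟩
  · obtain ⟨y, hy⟩ := ha.exists_right x
    by_cases hx : x ∈ A
    · obtain ⟨z, hzB, hz⟩ := hBt y ((hy.typeBelow_iff hpp).1 (hAb x hx))
      exact ⟨z, SameType.insert_iff.2 ⟨hy.trans hz.symm, iff_of_true hx hzB⟩⟩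
    · obtain ⟨z, hzB, hz⟩ := hBo y
      exact ⟨z, SameType.insert_iff.2 ⟨hy.trans hz.symm, iff_of_false hx hzB⟩⟩
  · obtain ⟨x, hx⟩ := ha.exists_left y
    by_cases hy : y ∈ B
    · obtain ⟨z, hzA, hz⟩ := hAt x ((hx.typeBelow_iff hpp).2 (hBb y hy))
      exact ⟨z, SameType.insert_iff.2 ⟨hz.trans hx, iff_of_true hzA hy⟩⟩
    · obtain ⟨z, hzA, hz⟩ := hAo x
      exact ⟨z, SameType.insert_iff.2 ⟨hz.trans hx, iff_of_false hzA hy⟩⟩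
  · refine SameType.insert_iff.2 ⟨ha.sameType p' hp', ?_⟩
    have hiff := ha.fst_eq_iff p' hp' p hp
    by_cases heq : p'.1 = p.1
    · rw [heq, hiff.1 heq]
      exact iff_of_true hpA hpB
    · exact iff_of_false (fun hx => (hAU hx).2 ⟨⟨p', hp', rfl⟩, heq⟩)
        (fun hy => (hBV hy).2 ⟨⟨p', hp', rfl⟩, fun h => heq (hiff.2 h)⟩)

end IsApprox

theorem Stratified.isApprox_empty (h : Stratified r) (h' : Stratified r') :
    IsApprox r r' ∅ ∅ where
  finite_sets := finite_empty
  finite_points := finite_empty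
  left := h.typeSystem_empty _ _
  right := h'.typeSystem_empty _ _
  exists_right x := by
    obtain ⟨y, hy⟩ := h'.exists_le (r x)
    obtain ⟨z, -, hz⟩ := mem_closure_iff.1 (h'.dense_stratum _ hy) univ isOpen_univ (mem_univ _)
    exact ⟨z, Eq.symm hz, by simp⟩
  exists_left y := by
    obtain ⟨x, hx⟩ := h.exists_le (r' y)
    obtain ⟨z, -, hz⟩ := mem_closure_iff.1 (h.dense_stratum _ hx) univ isOpen_univ (mem_univ _)
    exact ⟨z, hz, by simp⟩
  sameType := by simp
  fst_eq_iff := by simp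

/-- Any two countable second-countable stratified spaces are homeomorphic. -/
theorem Stratified.nonempty_homeomorph [Countable X] [SecondCountableTopology X] [Countable Y]
    [SecondCountableTopology Y] (h : Stratified r) (h' : Stratified r') : Nonempty (X ≃ₜ Y) := by
  let P := {s : Set (Set X × Set Y × ℕ) × Set (X × Y) // IsApprox r r' s.1 s.2}
  have := (countable_countableBasis X).to_subtype
  have := (countable_countableBasis Y).to_subtype
  have hpt : ∀ (s : P) x, ∃ s' : P, s ≤ s' ∧ x ∈ Prod.fst '' s'.1.2 := fun s x => by
    obtain ⟨F, hF, ha, hx⟩ := s.2.exists_mem_fst h' x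
    exact ⟨⟨(s.1.1, F), ha⟩, ⟨subset_rfl, hF⟩, hx⟩
  have hpt' : ∀ (s : P) y, ∃ s' : P, s ≤ s' ∧ y ∈ Prod.snd '' s'.1.2 := fun s y => by
    obtain ⟨F, hF, ha, hy⟩ := s.2.exists_mem_snd h y
    exact ⟨⟨(s.1.1, F), ha⟩, ⟨subset_rfl, hF⟩, hy⟩
  obtain ⟨f, hf, hfD⟩ := exists_monotone_seq_meets
    (ι := (X ⊕ Y) ⊕ ((X × countableBasis X) ⊕ (Y × countableBasis Y)))
    (⟨(∅, ∅), h.isApprox_empty h'⟩ : P)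
    (Sum.elim
      (Sum.elim (fun x => {s | x ∈ Prod.fst '' s.1.2}) (fun y => {s | y ∈ Prod.snd '' s.1.2}))
      (Sum.elim (fun a => {s | a.1 ∈ a.2.1 → ∃ q ∈ s.1.1, a.1 ∈ q.1 ∧ q.1 ⊆ a.2.1})
        (fun a => {s | a.1 ∈ a.2.1 → ∃ q ∈ s.1.1, a.1 ∈ q.2.1 ∧ q.2.1 ⊆ a.2.1})))
    (by
      rintro ((x | y) | (⟨x, U, hU⟩ | ⟨y, V, hV⟩)) s
      · obtain ⟨s', hs, hx⟩ := hpt s x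
        exact ⟨s', hx, hs⟩
      · obtain ⟨s', hs, hy⟩ := hpt' s y
        exact ⟨s', hy, hs⟩
      · by_cases hx : x ∈ U
        · obtain ⟨s', hs, p, hp, rfl⟩ := hpt s x
          obtain ⟨q, hq, hqU, -, ha⟩ := s'.2.exists_insert_set h h' hp
            (isOpen_of_mem_countableBasis hU) hx isOpen_univ (mem_univ _)
          exact ⟨⟨(insert q s'.1.1, s'.1.2), ha⟩, fun _ => ⟨q, mem_insert _ _, hq, hqU⟩,
            hs.trans ⟨subset_insert _ _, subset_rfl⟩⟩
        · exact ⟨s, fun h => absurd h hx, le_rfl⟩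
      · by_cases hy : y ∈ V
        · obtain ⟨s', hs, p, hp, rfl⟩ := hpt' s y
          obtain ⟨q, hq, -, hqV, ha⟩ := s'.2.exists_insert_set h h' hp isOpen_univ (mem_univ _)
            (isOpen_of_mem_countableBasis hV) hy
          exact ⟨⟨(insert q s'.1.1, s'.1.2), ha⟩, fun _ => ⟨q, mem_insert _ _,
            ((ha.sameType p hp).2 q (mem_insert _ _)).1 hq, hqV⟩,
            hs.trans ⟨subset_insert _ _, subset_rfl⟩⟩
        · exact ⟨s, fun h => absurd h hy, le_rfl⟩)
  have hx : ∀ x, ∃ y n, (x, y) ∈ (f n).1.2 := fun x => by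
    obtain ⟨n, ⟨x, y⟩, hp, rfl⟩ := hfD (Sum.inl (Sum.inl x))
    exact ⟨y, n, hp⟩
  have hy : ∀ y, ∃ x n, (x, y) ∈ (f n).1.2 := fun y => by
    obtain ⟨n, ⟨x, y⟩, hp, rfl⟩ := hfD (Sum.inl (Sum.inr y))
    exact ⟨x, n, hp⟩
  choose g i hg using hx
  choose g' j hg' using hy
  have hsame : ∀ {n l} {p : X × Y} {q}, p ∈ (f n).1.2 → q ∈ (f l).1.1 →
      (p.1 ∈ q.1 ↔ p.2 ∈ q.2.1) := fun {n l p q} hp hq =>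
    ((f (max n l)).2.sameType p ((hf (le_max_left _ _)).2 hp)).2 q ((hf (le_max_right _ _)).1 hq)
  have heq : ∀ {n k} {p p' : X × Y}, p ∈ (f n).1.2 → p' ∈ (f k).1.2 →
      (p.1 = p'.1 ↔ p.2 = p'.2) := fun {n k p p'} hp hp' =>
    (f (max n k)).2.fst_eq_iff p ((hf (le_max_left _ _)).2 hp) p' ((hf (le_max_right _ _)).2 hp')
  refine ⟨⟨⟨g, g', fun x => ?_, fun y => ?_⟩, ?_, ?_⟩⟩
  · exact (heq (hg' (g x)) (hg x)).2 rfl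
  · exact (heq (hg (g' y)) (hg' y)).1 rfl
  · refine continuous_iff_continuousAt.2 fun x => (nhds_basis_opens _).tendsto_right_iff.2 ?_
    rintro V ⟨hxV, hV⟩
    obtain ⟨W, hW, hxW, hWV⟩ := (isBasis_countableBasis Y).exists_subset_of_mem_open hxV hV
    obtain ⟨n, hn⟩ := hfD (Sum.inr (Sum.inr (g x, ⟨W, hW⟩)))
    obtain ⟨q, hq, hgq, hqW⟩ := hn hxW
    filter_upwards [((f n).2.left.clopenBelow q hq).isOpen.mem_nhds
      ((hsame (hg x) hq).2 hgq)] with z hz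
    exact hWV (hqW ((hsame (hg z) hq).1 hz))
  · refine continuous_iff_continuousAt.2 fun y => (nhds_basis_opens _).tendsto_right_iff.2 ?_
    rintro U ⟨hyU, hU⟩
    obtain ⟨W, hW, hyW, hWU⟩ := (isBasis_countableBasis X).exists_subset_of_mem_open hyU hU
    obtain ⟨n, hn⟩ := hfD (Sum.inr (Sum.inl (g' y, ⟨W, hW⟩)))
    obtain ⟨q, hq, hgq, hqW⟩ := hn hyW
    filter_upwards [((f n).2.right.clopenBelow q hq).isOpen.mem_nhds
      ((hsame (hg' y) hq).1 hgq)] with z hz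
    exact hWU (hqW ((hsame (hg' z) hq).2 hz))

end BackAndForth

/-- Every point of a countable regular second-countable space has a base of clopen
neighbourhoods. -/
theorem RegularHausdorff.exists_isClopen {X : Type*} [TopologicalSpace X] [Countable X]
    [SecondCountableTopology X] (h : RegularHausdorff X) {x : X} {U : Set X} (hU : IsOpen U)
    (hx : x ∈ U) : ∃ E, IsClopen E ∧ x ∈ E ∧ E ⊆ U := by
  have := h.1
  have := h.2
  exact (CompletelyRegularSpace.isTopologicalBasis_clopens_of_cardinalMk_lt_continuum
    ((Cardinal.mk_le_aleph0 (α := X)).trans_lt Cardinal.aleph0_lt_continuum)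
    ).exists_subset_of_mem_open hx hU

theorem VanishingSeq.antitone {X : Type*} [TopologicalSpace X] {A : ℕ → Set X}
    (h : VanishingSeq A) : Antitone A := antitone_nat_of_succ_le h.2.2.2

theorem VanishingSeq.exists_notMem {X : Type*} [TopologicalSpace X] {A : ℕ → Set X}
    (h : VanishingSeq A) (x : X) : ∃ n, x ∉ A n := by
  by_contra! hcon
  have : x ∈ ⋂ n, A n := mem_iInter.2 hcon
  rw [h.2.2.1] at this
  exact this

theorem VanishingSeq.exists_rank {X : Type*} [TopologicalSpace X] {A : ℕ → Set X}
    (h : VanishingSeq A) : ∃ r : X → ℕ, ∀ n, A n = {x | n ≤ r x} := by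
  have hex : ∀ x, ∃ n, x ∈ A n ∧ x ∉ A (n + 1) := by
    intro x
    by_contra! hcon
    obtain ⟨n, hn⟩ := h.exists_notMem x
    refine hn (Nat.rec ?_ hcon n)
    rw [h.2.1]
    trivial
  choose r hr using hex
  refine ⟨r, fun n => ext fun x => ⟨fun hx => ?_, fun hn => h.antitone hn (hr x).1⟩⟩
  by_contra hlt
  exact (hr x).2 (h.antitone (Nat.lt_of_not_le hlt) hx)

theorem IsSuperskeleton.t1Space {X : Type*} [TopologicalSpace X] {A : ℕ → Set X}
    (h : IsSuperskeleton A) : T1Space X := by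
  have hvan := h.1.1
  refine t1Space_iff_exists_open.2 fun x y hxy => ?_
  obtain ⟨m, hm⟩ := hvan.exists_notMem x
  obtain ⟨n, hn⟩ := hvan.exists_notMem y
  have := (h.1.2.2 (max m n)).1
  have hx : x ∈ (A (max m n))ᶜ := fun hx => hm (hvan.antitone (le_max_left _ _) hx)
  have hy : y ∈ (A (max m n))ᶜ := fun hy => hn (hvan.antitone (le_max_right _ _) hy)
  obtain ⟨U, hU, hxU, hyU⟩ := t1Space_iff_exists_open.1
    (inferInstance : T1Space ↥(A (max m n))ᶜ) (show (⟨x, hx⟩ : ↥(A (max m n))ᶜ) ≠ ⟨y, hy⟩ by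
      simpa using hxy)
  refine ⟨_, (hvan.1 _).isOpen_compl.isOpenMap_subtype_val U hU, ⟨_, hxU, rfl⟩, ?_⟩
  rintro ⟨w, hw, rfl⟩
  exact hyU hw

/-- Every member of a superskeleton is the closure of its difference with some later member. -/
theorem IsSuperskeleton.exists_subset_closure_diff {X : Type*} [TopologicalSpace X]
    {A : ℕ → Set X} (h : IsSuperskeleton A) (hne : ∀ n, (A n).Nonempty) (n : ℕ) :
    ∃ m, n < m ∧ A n ⊆ closure (A n \ A m) := by
  have hvan := h.1.1
  obtain ⟨x, hx⟩ := hne n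
  obtain ⟨k, hk⟩ := hvan.exists_notMem x
  obtain ⟨l, -, hl⟩ := h.2.2 n (A k)ᶜ (hvan.1 k).isOpen_compl ⟨x, hk, hx⟩
  refine ⟨max (max k l) (n + 1), by omega, fun y hy => ?_⟩
  have hanti := hvan.antitone
  by_cases hym : y ∈ A (max (max k l) (n + 1))
  · refine closure_mono ?_ (hl (hanti (by omega) hym))
    rintro z ⟨hz, hzn⟩
    exact ⟨hzn, fun hz' => hz (hanti (by omega) hz')⟩
  · exact subset_closure ⟨hy, hym⟩

theorem IsSuperskeleton.exists_stratified {X : Type*} [TopologicalSpace X] [Countable X]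
    [SecondCountableTopology X] {A : ℕ → Set X} (h : IsSuperskeleton A)
    (hne : ∀ n, (A n).Nonempty) : ∃ r : X → ℕ, Stratified r := by
  have hvan := h.1.1
  have hanti := hvan.antitone
  choose M hM hMc using h.exists_subset_closure_diff hne
  let φ : ℕ → ℕ := fun n => M^[n] 0
  have hφ : ∀ n, φ (n + 1) = M (φ n) := fun n => Function.iterate_succ_apply' _ _ _
  have hmono : StrictMono φ := strictMono_nat_of_lt_succ fun n => by
    rw [hφ]
    exact hM _
  have hvanφ : VanishingSeq (fun n => A (φ n)) := by
    refine ⟨fun n => hvan.1 _, hvan.2.1, ?_, fun n => hanti (hmono.monotone n.le_succ)⟩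
    refine eq_empty_of_forall_notMem fun x hx => ?_
    obtain ⟨n, hn⟩ := hvan.exists_notMem x
    exact hn (hanti (hmono.le_apply (x := n)) (mem_iInter.1 hx n))
  obtain ⟨r, hr⟩ := hvanφ.exists_rank
  have hstratum : ∀ n, A (φ n) \ A (φ (n + 1)) = {x | r x = n} := fun n => by
    rw [hr n, hr (n + 1)]
    ext x
    change (n ≤ r x ∧ ¬n + 1 ≤ r x) ↔ r x = n
    omega
  have hcompl : ∀ n, (A (φ n))ᶜ = {x | r x < n} := fun n => by
    rw [hr n]
    ext x
    change (¬n ≤ r x) ↔ r x < n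
    omega
  refine ⟨r, h.t1Space, fun n => hr n ▸ hvan.1 _, fun n => ?_, ?_, fun n => ?_, ?_⟩
  · obtain ⟨x, hx⟩ := hne (φ n)
    rw [hr n] at hx
    exact ⟨x, hx⟩
  · intro n x U hU hx hxn
    have hxA : x ∈ (A (φ n))ᶜ := by
      rw [hcompl n]
      exact hxn
    obtain ⟨E, hE, hxE, hEU⟩ := (h.1.2.2 (φ n)).exists_isClopen
      (hU.preimage continuous_subtype_val) (show (⟨x, hxA⟩ : ↥(A (φ n))ᶜ) ∈ _ from hx)
    refine ⟨Subtype.val '' E, (hvan.1 _).isOpen_compl.isOpenMap_subtype_val E hE.isOpen,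
      ⟨_, hxE, rfl⟩, image_subset_iff.2 hEU, ?_, fun y hy => ?_⟩
    · rw [← hcompl n]
      rintro _ ⟨y, -, rfl⟩
      exact y.2
    · by_cases hyA : y ∈ A (φ n)
      · right
        rwa [hr n] at hyA
      · have hyE : (⟨y, hyA⟩ : ↥(A (φ n))ᶜ) ∈ closure E := closure_subtype.2 hy
        rw [hE.isClosed.closure_eq] at hyE
        exact Or.inl ⟨_, hyE, rfl⟩
  · rw [← hstratum, ← hr n, hφ]
    exact hMc _
  · rintro n V hV ⟨x, hxV, hx⟩
    have hset : V ∩ {x | r x = n} = (V ∩ (A (φ (n + 1)))ᶜ) ∩ A (φ n) := by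
      rw [← hstratum, sdiff_eq, inter_assoc, inter_comm (A (φ n))]
    rw [hset]
    obtain ⟨m, -, hm⟩ := h.2.2 (φ n) (V ∩ (A (φ (n + 1)))ᶜ)
      (hV.inter (hvan.1 _).isOpen_compl) (hset ▸ ⟨x, hxV, hx⟩)
    refine ⟨m, Subset.trans ?_ hm⟩
    rw [← hr m]
    exact hanti hmono.le_apply

theorem regularHausdorff_compl {X : Type*} [TopologicalSpace X] [T1Space X] {S : Set X}
    (h : ∀ x ∉ S, ∀ U, IsOpen U → x ∈ U → ∃ V, IsOpen V ∧ x ∈ V ∧ closure V ⊆ U ∪ S) :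
    RegularHausdorff ↥Sᶜ := by
  have : RegularSpace ↥Sᶜ := by
    refine .of_exists_mem_nhds_isClosed_subset fun x s hs => ?_
    obtain ⟨t, ht, hts⟩ := mem_nhds_subtype _ _ _ |>.1 hs
    obtain ⟨U, hUt, hU, hxU⟩ := mem_nhds_iff.1 ht
    obtain ⟨V, hV, hxV, hVU⟩ := h x x.2 U hU hxU
    refine ⟨Subtype.val ⁻¹' closure V, ?_, isClosed_closure.preimage continuous_subtype_val, ?_⟩
    · exact continuous_subtype_val.continuousAt
        (Filter.mem_of_superset (hV.mem_nhds hxV) subset_closure)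
    · intro y hy
      exact hts (hUt ((hVU hy).resolve_right y.2))
  have : T3Space ↥Sᶜ := ⟨⟩
  exact ⟨inferInstance, inferInstance⟩

theorem MInvariant.preimage_image {G X Z : Type*} [Group G] [MulAction G X] {q : X → Z}
    (hqG : ∀ x y, q x = q y ↔ x ∈ MulAction.orbit G y) {B : Set X} (hB : MInvariant G B) :
    q ⁻¹' (q '' B) = B := by
  refine (subset_preimage_image q B).antisymm' ?_
  rintro x ⟨y, hy, hxy⟩
  obtain ⟨g, rfl⟩ := (hqG x y).1 hxy.symm
  exact hB g y hy

theorem mInvariant_preimage {G X Z : Type*} [Group G] [MulAction G X] {q : X → Z}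
    (hqG : ∀ x y, q x = q y ↔ x ∈ MulAction.orbit G y) (B : Set Z) : MInvariant G (q ⁻¹' B) := by
  intro g x hx
  rwa [mem_preimage, (hqG (g • x) x).2 ⟨g, rfl⟩]

/-- The image of a suitable vanishing sequence of invariant sets under an open quotient map whose
fibres are the orbits is a superskeleton. -/
theorem IsOpenQuotientMap.isSuperskeleton_image {G X Z : Type*} [Group G]
    [TopologicalSpace X] [TopologicalSpace Z] [MulAction G X] {q : X → Z}
    (hq : IsOpenQuotientMap q)
    (hqG : ∀ x y, q x = q y ↔ x ∈ MulAction.orbit G y)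
    (horb : ∀ x : X, IsClosed (MulAction.orbit G x))
    {A : ℕ → Set X} (hvan : VanishingSeq A) (hne : ∀ n, (A n).Nonempty)
    (hinv : ∀ n, MInvariant G (A n))
    (h1 : ∀ (n : ℕ) (U : Set X), U ⊆ A n → (∃ V, IsOpen V ∧ U = V ∩ A n) →
      MInvariant G U → U.Nonempty → ∃ m, A m ⊆ closure U)
    (h2 : ∀ (n : ℕ), ∀ x ∉ A n, ∀ U : Set X, IsOpen U → MInvariant G U → x ∈ U →
      ∃ V : Set X, IsOpen V ∧ MInvariant G V ∧ x ∈ V ∧ closure V ⊆ U ∪ A n) :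
    IsSuperskeleton (fun n => q '' A n) := by
  have hpre : ∀ n, q ⁻¹' (q '' A n) = A n := fun n => (hinv n).preimage_image hqG
  have hclos : ∀ B : Set Z, q ⁻¹' closure B = closure (q ⁻¹' B) :=
    hq.isOpenMap.preimage_closure_eq_closure_preimage hq.continuous
  have hvan' : VanishingSeq (fun n => q '' A n) := by
    refine ⟨fun n => ?_, ?_, ?_, fun n => image_mono (hvan.2.2.2 n)⟩
    · rw [← hq.isQuotientMap.isClosed_preimage, hpre]
      exact hvan.1 n
    · simp [hvan.2.1, hq.surjective.range_eq]
    · apply hq.surjective.preimage_injective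
      simp only [preimage_iInter, hpre, hvan.2.2.1, preimage_empty]
  have hsuper : ∀ (n : ℕ) (V : Set Z), IsOpen V → (V ∩ q '' A n).Nonempty →
      ∃ m, (q '' A m).Nonempty ∧ q '' A m ⊆ closure (V ∩ q '' A n) := by
    intro n V hV hVne
    have hU : q ⁻¹' (V ∩ q '' A n) = q ⁻¹' V ∩ A n := by rw [preimage_inter, hpre]
    obtain ⟨m, hm⟩ := h1 n (q ⁻¹' (V ∩ q '' A n)) (hU ▸ inter_subset_right)
      ⟨_, hV.preimage hq.continuous, hU⟩ (mInvariant_preimage hqG _)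
      (hVne.preimage hq.surjective)
    exact ⟨m, (hne m).image q, image_subset_iff.2 (by rwa [hclos])⟩
  have : T1Space Z := ⟨fun z => by
    obtain ⟨x, rfl⟩ := hq.surjective z
    rw [← hq.isQuotientMap.isClosed_preimage]
    convert horb x using 1
    ext y
    exact hqG y x⟩
  refine ⟨⟨hvan', fun U hU hUne => ?_, fun n => regularHausdorff_compl ?_⟩, hvan', hsuper⟩
  · have h0 : q '' A 0 = univ := hvan'.2.1
    obtain ⟨m, -, hm⟩ := hsuper 0 U hU (by rwa [h0, inter_univ])
    exact ⟨m, by rwa [h0, inter_univ] at hm⟩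
  · intro z hz U hU hzU
    obtain ⟨x, rfl⟩ := hq.surjective z
    obtain ⟨V, hV, hVG, hxV, hVU⟩ := h2 n x (fun hx => hz ⟨x, hx, rfl⟩) (q ⁻¹' U)
      (hU.preimage hq.continuous) (mInvariant_preimage hqG U) hzU
    refine ⟨q '' V, hq.isOpenMap V hV, ⟨x, hxV, rfl⟩, ?_⟩
    rw [← hq.surjective.preimage_subset_preimage_iff, hclos, hVG.preimage_image hqG,
      preimage_union, hpre]
    exact hVU

section RationalProjectiveSpace

instance : MulAction ℚˣ (ProjPoint ℚ) where
  smul g x := ⟨(g : ℚ) • x.1, x.2.1.subset fun n hn => by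
      simp only [mem_ofPred_eq, Pi.smul_apply, smul_eq_mul] at hn ⊢
      exact right_ne_zero_of_mul hn,
    smul_ne_zero g.ne_zero x.2.2⟩
  one_smul x := Subtype.ext (one_smul ℚ x.1)
  mul_smul g h x := Subtype.ext (mul_smul (g : ℚ) (h : ℚ) x.1)

theorem ProjPoint.smul_apply (g : ℚˣ) (x : ProjPoint ℚ) (n : ℕ) :
    (g • x).1 n = g * x.1 n := rfl

instance : ContinuousConstSMul ℚˣ (ProjPoint ℚ) where
  continuous_const_smul g :=
    (continuous_subtype_val.const_smul (g : ℚ)).subtype_mk _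

theorem orbitRel_projPoint : MulAction.orbitRel ℚˣ (ProjPoint ℚ) = projSetoid ℚ := by
  ext x y
  rw [MulAction.orbitRel_apply]
  constructor
  · rintro ⟨g, rfl⟩
    exact ⟨g, g.ne_zero, rfl⟩
  · rintro ⟨l, hl, h⟩
    exact ⟨Units.mk0 l hl, Subtype.ext h.symm⟩

theorem ProjPoint.exists_ne_zero (x : ProjPoint ℚ) : ∃ n, x.1 n ≠ 0 := by
  by_contra! h
  exact x.2.2 (funext h)

/-- The finitely supported nonzero sequences whose first `n` entries vanish. -/
def ProjPoint.tail (n : ℕ) : Set (ProjPoint ℚ) := {x | ∀ i < n, x.1 i = 0}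

theorem ProjPoint.continuous_apply (i : ℕ) : Continuous fun x : ProjPoint ℚ => x.1 i :=
  (_root_.continuous_apply i).comp continuous_subtype_val

theorem ProjPoint.isClosed_orbit (x : ProjPoint ℚ) : IsClosed (MulAction.orbit ℚˣ x) := by
  have : MulAction.orbit ℚˣ x = ⋂ (i) (j), {y : ProjPoint ℚ | y.1 i * x.1 j = y.1 j * x.1 i} := by
    ext y
    simp only [mem_iInter, mem_ofPred_eq]
    constructor
    · rintro ⟨g, rfl⟩ i j
      simp only [ProjPoint.smul_apply]
      ring
    · intro h
      obtain ⟨j, hj⟩ := x.exists_ne_zero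
      obtain ⟨i, hi⟩ := y.exists_ne_zero
      have hyj : y.1 j ≠ 0 := fun h0 => by
        have := h i j
        rw [h0, zero_mul] at this
        exact (mul_ne_zero hi hj) this
      refine ⟨Units.mk0 (y.1 j / x.1 j) (div_ne_zero hyj hj), Subtype.ext (funext fun k => ?_)⟩
      rw [ProjPoint.smul_apply, Units.val_mk0, div_mul_eq_mul_div, div_eq_iff hj, h k j]
  rw [this]
  exact isClosed_iInter fun i => isClosed_iInter fun j => isClosed_eq
    ((ProjPoint.continuous_apply i).mul_const _) ((ProjPoint.continuous_apply j).mul_const _)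

theorem ProjPoint.exists_box {U : Set (ProjPoint ℚ)} (hU : IsOpen U) {x : ProjPoint ℚ}
    (hx : x ∈ U) : ∃ (k : ℕ) (ε : ℚ), 0 < ε ∧
      ∀ y : ProjPoint ℚ, (∀ i < k, |y.1 i - x.1 i| < ε) → y ∈ U := by
  obtain ⟨W, hW, rfl⟩ := isOpen_induced_iff.1 hU
  obtain ⟨I, u, hu, huW⟩ := isOpen_pi_iff.1 hW x.1 hx
  have hε : ∀ i ∈ I, ∃ ε : ℚ, 0 < ε ∧ ∀ z, |z - x.1 i| < ε → z ∈ u i := by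
    intro i hi
    obtain ⟨δ, hδ, hδu⟩ := Metric.isOpen_iff.1 (hu i hi).1 (x.1 i) (hu i hi).2
    obtain ⟨ε, hε, hεδ⟩ := exists_rat_btwn hδ
    refine ⟨ε, by exact_mod_cast hε, fun z hz => hδu ?_⟩
    rw [Metric.mem_ball, Rat.dist_eq]
    refine lt_trans ?_ hεδ
    exact_mod_cast hz
  choose! e he heu using hε
  obtain ⟨k, hk⟩ := I.exists_nat_subset_range
  obtain ⟨ε, hε, hεe⟩ : ∃ ε : ℚ, 0 < ε ∧ ∀ i ∈ I, ε ≤ e i := by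
    rcases I.eq_empty_or_nonempty with rfl | hne
    · exact ⟨1, one_pos, by simp⟩
    · exact ⟨I.inf' hne e, (Finset.lt_inf'_iff hne).2 he, fun i hi => Finset.inf'_le e hi⟩
  refine ⟨k, ε, hε, fun y hy => huW fun i hi => heu i hi _ ?_⟩
  exact (hy i (Finset.mem_range.1 (hk hi))).trans_le (hεe i hi)

theorem ProjPoint.vanishingSeq_tail : VanishingSeq ProjPoint.tail := by
  refine ⟨fun n => ?_, by simp [ProjPoint.tail], ?_,
    fun n x hx i hi => hx i (hi.trans n.lt_succ_self)⟩
  · simp only [ProjPoint.tail, ofPred_forall]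
    exact isClosed_biInter fun i _ => isClosed_eq (ProjPoint.continuous_apply i) continuous_const
  · refine eq_empty_of_forall_notMem fun x hx => ?_
    obtain ⟨n, hn⟩ := x.exists_ne_zero
    exact hn (mem_iInter.1 hx (n + 1) n n.lt_succ_self)

theorem ProjPoint.nonempty_tail (n : ℕ) : (ProjPoint.tail n).Nonempty := by
  refine ⟨⟨Pi.single n 1, (finite_singleton n).subset fun i hi => ?_, by simp⟩, fun i hi => ?_⟩
  · by_contra h
    exact hi (Pi.single_eq_of_ne h 1)
  · exact Pi.single_eq_of_ne hi.ne 1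

theorem ProjPoint.mInvariant_tail (n : ℕ) : MInvariant ℚˣ (ProjPoint.tail n) := by
  intro g x hx i hi
  rw [ProjPoint.smul_apply, hx i hi, mul_zero]

theorem ProjPoint.exists_tail_subset_closure {n : ℕ} {U V : Set (ProjPoint ℚ)} (hV : IsOpen V)
    (hUV : U = V ∩ ProjPoint.tail n) (hU : MInvariant ℚˣ U) (hne : U.Nonempty) :
    ∃ m, ProjPoint.tail m ⊆ closure U := by
  obtain ⟨x, hx⟩ := hne
  have hx' := hx
  rw [hUV] at hx'
  obtain ⟨k, ε, hε, hbox⟩ := ProjPoint.exists_box hV hx'.1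
  obtain ⟨j, hj⟩ := x.exists_ne_zero
  refine ⟨max (max k n) (j + 1), fun y hy => ?_⟩
  have hfin : ∀ c : ℚ, {i | (x.1 + c • y.1) i ≠ 0}.Finite := fun c =>
    (x.2.1.union y.2.1).subset fun i hi => by
      by_contra hcon
      simp only [mem_union, mem_ofPred_eq, not_or, not_not] at hcon
      exact hi (by simp [hcon.1, hcon.2])
  have hsmall : ∀ c : ℚ, ∀ i < max (max k n) (j + 1), (x.1 + c • y.1) i = x.1 i :=
    fun c i hi => by simp [hy i hi]
  have hnz : ∀ c : ℚ, x.1 + c • y.1 ≠ 0 := fun c h0 => by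
    have := hsmall c j (by omega)
    rw [h0] at this
    exact hj this.symm
  let w : ℚ → ProjPoint ℚ := fun c => ⟨x.1 + c • y.1, hfin c, hnz c⟩
  have hw : ∀ c, w c ∈ U := by
    intro c
    rw [hUV]
    refine ⟨hbox _ fun i hi => ?_, fun i hi => ?_⟩
    · rw [show (w c).1 i = x.1 i from hsmall c i (by omega), sub_self, abs_zero]
      exact hε
    · exact (hsmall c i (by omega)).trans (hx'.2 i hi)
  let t : ℕ → ℚˣ := fun a => Units.mk0 (1 / ((a : ℚ) + 1)) (by positivity)
  refine mem_closure_of_tendsto (f := fun a : ℕ => t a • w ((a : ℚ) + 1)) (b := Filter.atTop) ?_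
    (Filter.Eventually.of_forall fun a => hU _ _ (hw _))
  rw [tendsto_subtype_rng, tendsto_pi_nhds]
  intro i
  have hlim : Filter.Tendsto (fun a : ℕ => 1 / ((a : ℚ) + 1) * x.1 i + y.1 i) Filter.atTop
      (𝓝 (0 * x.1 i + y.1 i)) :=
    ((tendsto_one_div_add_atTop_nhds_zero_nat (𝕜 := ℚ)).mul_const _).add_const _
  rw [zero_mul, zero_add] at hlim
  refine hlim.congr fun a => ?_
  have ha : ((a : ℚ) + 1) ≠ 0 := by positivity
  simp only [ProjPoint.smul_apply, t, w, Units.val_mk0, Pi.add_apply, Pi.smul_apply, smul_eq_mul]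
  field_simp

theorem ProjPoint.exists_invariant_closure_subset {n : ℕ} {x : ProjPoint ℚ}
    (hx : x ∉ ProjPoint.tail n) {U : Set (ProjPoint ℚ)} (hU : IsOpen U) (hUG : MInvariant ℚˣ U)
    (hxU : x ∈ U) : ∃ V, IsOpen V ∧ MInvariant ℚˣ V ∧ x ∈ V ∧ closure V ⊆ U ∪ ProjPoint.tail n := by
  obtain ⟨i, hi, hxi⟩ : ∃ i < n, x.1 i ≠ 0 := by
    simpa [ProjPoint.tail] using hx
  obtain ⟨k, ε, hε, hbox⟩ := ProjPoint.exists_box hU hxU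
  have hcont : ∀ j, Continuous fun z : ProjPoint ℚ => |z.1 j * x.1 i - z.1 i * x.1 j| := fun j =>
    (((ProjPoint.continuous_apply j).mul_const _).sub
      ((ProjPoint.continuous_apply i).mul_const _)).abs
  have hcont' : Continuous fun z : ProjPoint ℚ => ε / 2 * |z.1 i| :=
    ((ProjPoint.continuous_apply i).abs).const_mul _
  refine ⟨⋂ j ∈ Iio (max k n), {z | |z.1 j * x.1 i - z.1 i * x.1 j| < ε / 2 * |z.1 i|},
    (finite_Iio _).isOpen_biInter fun j _ => isOpen_lt (hcont j) hcont', ?_, ?_, ?_⟩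
  · intro g z hz
    simp only [mem_iInter, mem_ofPred_eq, ProjPoint.smul_apply] at hz ⊢
    intro j hj
    have hg : 0 < |(g : ℚ)| := abs_pos.2 g.ne_zero
    calc |g * z.1 j * x.1 i - g * z.1 i * x.1 j|
        = |(g : ℚ)| * |z.1 j * x.1 i - z.1 i * x.1 j| := by rw [← abs_mul]; ring_nf
      _ < |(g : ℚ)| * (ε / 2 * |z.1 i|) := by gcongr; exact hz j hj
      _ = ε / 2 * |g * z.1 i| := by rw [abs_mul]; ring
  · simp only [mem_iInter, mem_ofPred_eq]
    intro j _
    rw [mul_comm (x.1 i), sub_self, abs_zero]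
    have := abs_pos.2 hxi
    positivity
  · have hcl : closure (⋂ j ∈ Iio (max k n),
        {z : ProjPoint ℚ | |z.1 j * x.1 i - z.1 i * x.1 j| < ε / 2 * |z.1 i|}) ⊆
        ⋂ j ∈ Iio (max k n), {z | |z.1 j * x.1 i - z.1 i * x.1 j| ≤ ε / 2 * |z.1 i|} :=
      closure_minimal (iInter₂_mono fun j _ z hz => hz.out.le)
        (isClosed_biInter fun j _ => isClosed_le (hcont j) hcont')
    intro z hz
    have hz := hcl hz
    simp only [mem_iInter, mem_ofPred_eq, mem_Iio] at hz
    by_cases hzi : z.1 i = 0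
    · refine Or.inr fun j hj => ?_
      have := hz j (by omega)
      rw [hzi, zero_mul, sub_zero, abs_zero, mul_zero, abs_nonpos_iff] at this
      exact (mul_eq_zero.1 this).resolve_right hxi
    · left
      let g : ℚˣ := Units.mk0 (x.1 i / z.1 i) (div_ne_zero hxi hzi)
      rw [← inv_smul_smul g z]
      refine hUG _ _ (hbox _ fun j hj => ?_)
      have hgz : (g • z).1 j - x.1 j = (z.1 j * x.1 i - z.1 i * x.1 j) / z.1 i := by
        rw [ProjPoint.smul_apply, Units.val_mk0]
        field_simp
      rw [hgz, abs_div, div_lt_iff₀ (abs_pos.2 hzi)]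
      refine (hz j (by omega)).trans_lt ?_
      have := abs_pos.2 hzi
      gcongr
      exact half_lt_self hε

instance : Countable (ProjPoint ℚ) := by
  refine Function.Injective.countable (β := ℕ →₀ ℚ)
    (f := fun x => Finsupp.ofSupportFinite x.1 x.2.1) fun x y hxy => ?_
  exact Subtype.ext (congrArg (fun f : ℕ →₀ ℚ => (f : ℕ → ℚ)) hxy)

theorem isOpenQuotientMap_mk_projSetoid :
    IsOpenQuotientMap (Quotient.mk (projSetoid ℚ)) := by
  rw [← orbitRel_projPoint]
  exact MulAction.isOpenQuotientMap_quotientMk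

instance : SecondCountableTopology QPinf :=
  have : SecondCountableTopology (ProjPoint ℚ) :=
    TopologicalSpace.Subtype.secondCountableTopology _
  isOpenQuotientMap_mk_projSetoid.isQuotientMap.secondCountableTopology
    isOpenQuotientMap_mk_projSetoid.isOpenMap

theorem exists_stratified_qpinf : ∃ r : QPinf → ℕ, Stratified r := by
  have h := isOpenQuotientMap_mk_projSetoid.isSuperskeleton_image (G := ℚˣ)
    (fun x y => by
      rw [Quotient.eq, ← orbitRel_projPoint]
      exact MulAction.orbitRel_apply)
    ProjPoint.isClosed_orbit ProjPoint.vanishingSeq_tail ProjPoint.nonempty_tail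
    ProjPoint.mInvariant_tail
    (fun n U _ ⟨V, hV, hUV⟩ hU hne => ProjPoint.exists_tail_subset_closure hV hUV hU hne)
    (fun n x hx U hU hUG hxU => ProjPoint.exists_invariant_closure_subset hx hU hUG hxU)
  exact h.exists_stratified fun n => (ProjPoint.nonempty_tail n).image _

end RationalProjectiveSpace

theorem IsOpenQuotientMap.firstCountableTopology {X Z : Type*} [TopologicalSpace X]
    [TopologicalSpace Z] [FirstCountableTopology X] {q : X → Z} (hq : IsOpenQuotientMap q) :
    FirstCountableTopology Z where
  nhds_generated_countable z := by
    obtain ⟨x, rfl⟩ := hq.surjective z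
    rw [← hq.map_nhds_eq]
    infer_instance

/-- orbit spaces of nice group actions have superskeleta, and are
homeomorphic to ℚP^∞ when X is first-countable and the orbit space is countable. -/
theorem orbit_space_superskeleton (G X : Type*) [Group G] [TopologicalSpace X]
    [MulAction G X]
    (hcont : ∀ g : G, Continuous fun x : X => g • x)
    (horb : ∀ x : X, IsClosed (MulAction.orbit G x))
    (A : ℕ → Set X) (hvan : VanishingSeq A) (hne : ∀ n, (A n).Nonempty)
    (hinv : ∀ n, MInvariant G (A n))
    (h1 : ∀ (n : ℕ) (U : Set X), U ⊆ A n → (∃ V, IsOpen V ∧ U = V ∩ A n) →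
      MInvariant G U → U.Nonempty → ∃ m, A m ⊆ closure U)
    (h2 : ∀ (n : ℕ), ∀ x ∉ A n, ∀ U : Set X, IsOpen U → MInvariant G U → x ∈ U →
      ∃ V : Set X, IsOpen V ∧ MInvariant G V ∧ x ∈ V ∧ closure V ⊆ U ∪ A n) :
    (∃ S : ℕ → Set (Quotient (MulAction.orbitRel G X)), IsSuperskeleton S) ∧
    (FirstCountableTopology X → Countable (Quotient (MulAction.orbitRel G X)) →
      Nonempty (Quotient (MulAction.orbitRel G X) ≃ₜ QPinf)) := by
  have : ContinuousConstSMul G X := ⟨hcont⟩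
  have hq : IsOpenQuotientMap (Quotient.mk (MulAction.orbitRel G X)) :=
    MulAction.isOpenQuotientMap_quotientMk
  have hS := hq.isSuperskeleton_image (G := G)
    (fun x y => Quotient.eq.trans MulAction.orbitRel_apply) horb hvan hne hinv h1 h2
  refine ⟨⟨_, hS⟩, fun _ _ => ?_⟩
  have := hq.firstCountableTopology
  obtain ⟨r, hr⟩ := hS.exists_stratified fun n => (hne n).image _
  obtain ⟨r', hr'⟩ := exists_stratified_qpinf
  exact hr.nonempty_homeomorph hr'
end
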